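/- arXiv:2401.14605 — 2 statements merged into one kernel-verified Lean document; each statement's English description precedes it below -/
import Mathlib

section
/- Let X be a standard Borel space and let E be an aperiodic hyperfinite Borel equivalence relation on X. Let n, k > 1 be integers. Then for every Borel almost transitive E-coloring c : [X]^n_E → {1,…,k}, there is a Borel monochromatic reduction to E_1 for c. -/
open Classical

noncomputable section

/-- `Y` is a complete section for `E`: it meets every `E`-class. -/
def IsCompleteSection {X : Type*} (E : X → X → Prop) (Y : Set X) : Prop :=
  ∀ x : X, ∃ y ∈ Y, E x y

/-- `Y` is an infinite complete section for `E`: it meets every `E`-class in an infinite set. -/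
def IsInfiniteCompleteSection {X : Type*} (E : X → X → Prop) (Y : Set X) : Prop :=
  ∀ x : X, {y | y ∈ Y ∧ E x y}.Infinite

/-- A coloring `c` of the `n`-element subsets of single `E`-classes (encoded as a function on
finsets) is `E`-monochromatic on `Y`: for every `x` there is a color `a` such that every
`n`-element subset of `Y` contained in `[x]_E` gets color `a`. -/
def IsMonochromatic {X : Type*} (E : X → X → Prop) (n : ℕ) {k : ℕ}
    (c : Finset X → Fin k) (Y : Set X) : Prop :=
  ∀ x : X, ∃ a : Fin k, ∀ A : Finset X, A.card = n → ↑A ⊆ Y → (∀ y ∈ A, E x y) → c A = a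

/-- `c` is a Borel coloring of dimension `n`: the induced map on `n`-tuples is measurable. -/
def IsBorelColoring {X : Type*} [MeasurableSpace X] (n : ℕ) {k : ℕ}
    (c : Finset X → Fin k) : Prop :=
  Measurable fun v : Fin n → X => c (Set.finite_range v).toFinset

/-- The strong Borel Ramsey property `E →_B (E)^n_k`: every Borel `E`-coloring of dimension
`n` by `k` colors admits a Borel `E`-monochromatic infinite complete section. -/
def StrongBorelRamsey {X : Type*} [MeasurableSpace X] (E : X → X → Prop) (n k : ℕ) : Prop :=
  ∀ c : Finset X → Fin k, IsBorelColoring n c →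
    ∃ Y : Set X, MeasurableSet Y ∧ IsInfiniteCompleteSection E Y ∧ IsMonochromatic E n c Y

/-- The weak Borel Ramsey property `E →*_B (E)^n_k`: every Borel `E`-coloring of dimension
`n` by `k` colors admits a Borel `E`-monochromatic complete section. -/
def WeakBorelRamsey {X : Type*} [MeasurableSpace X] (E : X → X → Prop) (n k : ℕ) : Prop :=
  ∀ c : Finset X → Fin k, IsBorelColoring n c →
    ∃ Y : Set X, MeasurableSet Y ∧ IsCompleteSection E Y ∧ IsMonochromatic E n c Y

/-- `E` is smooth: Borel reducible to equality on a standard Borel space. -/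
def IsSmooth {X : Type*} [MeasurableSpace X] (E : X → X → Prop) : Prop :=
  ∃ (Z : Type) (mZ : MeasurableSpace Z), @StandardBorelSpace Z mZ ∧
    ∃ f : X → Z, @Measurable X Z _ mZ f ∧ ∀ x y : X, E x y ↔ f x = f y

/-- The eventual agreement relation `E₀` on Cantor space `2^ℕ`. -/
def E0 (x y : ℕ → Bool) : Prop := ∃ n : ℕ, ∀ m ≥ n, x m = y m

/-- `Σ_{i<δ(x,y)} x i + Σ_{i<δ(x,y)} y i`, where `δ(x,y)` is the least `n` with
`x m = y m` for all `m ≥ n`; junk value `0` if `x` and `y` are not `E₀`-related. -/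
def colorSum (x y : ℕ → Bool) : ℕ :=
  if h : ∃ n : ℕ, ∀ m ≥ n, x m = y m then
    ((Finset.range (Nat.find h)).sum fun i => (x i).toNat) +
    ((Finset.range (Nat.find h)).sum fun i => (y i).toNat)
  else 0

/-- The coloring `c` of the paper: a pair `{x,y}` of distinct `E₀`-related points gets color
`0` (representing color `1`) if `colorSum x y` is even, and color `1` (representing color `2`)
otherwise. -/
def c0 : Finset (ℕ → Bool) → Fin 2 := fun A =>
  if ∃ x y : ℕ → Bool, x ≠ y ∧ A = {x, y} ∧ E0 x y ∧ Even (colorSum x y) then 0 else 1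

/-- The subrelation `F` of `E₀`: `x F y` iff `x = y` or `c ({x,y}) = 1` (even `colorSum`). -/
def F0 (x y : ℕ → Bool) : Prop := x = y ∨ (E0 x y ∧ Even (colorSum x y))

/-- The map flipping coordinate `0`. -/
def flip0 (x : ℕ → Bool) : ℕ → Bool := fun n => if n = 0 then !(x 0) else x n

/-- Eventual agreement of `X`-valued sequences: the relation `E₀(X)` on `X^ℕ`
(denoted `E₁` when `X` is uncountable). -/
def E1rel {X : Type*} (u v : ℕ → X) : Prop := ∃ N : ℕ, ∀ j ≥ N, u j = v j

/-- `S` is a monochromatic reduction to `E₁` for the coloring `c` of dimension `n`: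
each `S x` is injective, its range is a monochromatic subset of `[x]_E`, and
`x E y ↔ S x E₁ S y`. -/
def IsMonochromaticReduction {X : Type*} (E : X → X → Prop) (n : ℕ) {k : ℕ}
    (c : Finset X → Fin k) (S : X → ℕ → X) : Prop :=
  (∀ x : X, Function.Injective (S x)) ∧
  (∀ x : X, (∀ i : ℕ, E x (S x i)) ∧
    ∃ a : Fin k, ∀ A : Finset X, A.card = n → ↑A ⊆ Set.range (S x) → c A = a) ∧
  (∀ x y : X, E x y ↔ E1rel (S x) (S y))

/-- `c` is an almost transitive coloring of dimension `n` for `E`: for every `m ≥ n`, every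
`A ∈ [X]^m_E` and all `(n-1)`-element subsets `B₁, B₂ ⊆ A`, one has
`c ({z} ∪ B₁) = c ({z} ∪ B₂)` for all but finitely many `z` in the `E`-saturation of `A`
outside `B₁ ∪ B₂`. -/
def AlmostTransitive {X : Type*} (E : X → X → Prop) (n : ℕ) {k : ℕ}
    (c : Finset X → Fin k) : Prop :=
  ∀ m : ℕ, n ≤ m → ∀ A : Finset X, A.card = m → (∀ x ∈ A, ∀ y ∈ A, E x y) →
    ∀ B₁ B₂ : Finset X, B₁ ⊆ A → B₂ ⊆ A → B₁.card = n - 1 → B₂.card = n - 1 →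
      {z : X | (∃ a ∈ A, E a z) ∧ z ∉ B₁ ∪ B₂ ∧ c (insert z B₁) ≠ c (insert z B₂)}.Finite

/-- A sequence of sets is (Novikov) separated if it is covered by Borel sets with empty
intersection. -/
def NovSep {X : Type*} [MeasurableSpace X] (A : ℕ → Set X) : Prop :=
  ∃ B : ℕ → Set X, (∀ i, MeasurableSet (B i)) ∧ (∀ i, A i ⊆ B i) ∧ ∀ x, ∃ i, x ∉ B i

open PiNat in
/-- Novikov's separation theorem for ranges. -/
theorem novSep_range {X : Type*} [TopologicalSpace X] [T2Space X] [MeasurableSpace X]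
    [OpensMeasurableSpace X] (f : ℕ → (ℕ → ℕ) → X) (hf : ∀ i, Continuous (f i))
    (h : ∀ x, ∃ i, x ∉ Set.range (f i)) : NovSep (fun i => Set.range (f i)) := by
  by_contra hns
  let g : ℕ → (ℕ → ℕ) → X := fun i w => f i (fun m => w (Nat.pair i m))
  have hg : ∀ i, Continuous (g i) := fun i => (hf i).comp (by fun_prop)
  have step : ∀ (l : ℕ) (w : ℕ → ℕ), ¬ NovSep (fun i => g i '' cylinder w l) →
      ∃ w', w' ∈ cylinder w l ∧ ¬ NovSep (fun i => g i '' cylinder w' (l + 1)) := by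
    intro l w
    contrapose!
    intro H
    have H' : ∀ m : ℕ, NovSep (fun i => g i '' cylinder (Function.update w l m) (l + 1)) :=
      fun m => H _ (update_mem_cylinder _ _ _)
    choose B hBm hBs hBe using H'
    refine ⟨fun i => if i = (Nat.unpair l).1 then ⋃ m, B m i else ⋂ m, B m i, ?_, ?_, ?_⟩
    · intro i
      dsimp only
      split_ifs
      · exact MeasurableSet.iUnion fun m => hBm m i
      · exact MeasurableSet.iInter fun m => hBm m i
    · intro i
      dsimp only
      split_ifs with hi
      · rw [← iUnion_cylinder_update w l, Set.image_iUnion]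
        exact Set.iUnion_mono fun m => hBs m i
      · rintro _ ⟨v, hv, rfl⟩
        refine Set.mem_iInter.2 fun m => ?_
        refine hBs m i ⟨Function.update v l m, ?_, ?_⟩
        · intro j hj
          by_cases hjl : j = l
          · subst hjl; simp
          · simp only [Function.update_of_ne hjl]
            exact hv j (by omega)
        · simp only [g]
          congr 1
          ext j
          rw [Function.update_of_ne]
          rintro rfl
          simp at hi
    · intro x
      by_cases hx : ∃ m, x ∈ B m (Nat.unpair l).1
      · obtain ⟨m, hm⟩ := hx
        obtain ⟨i, hi⟩ := hBe m x
        refine ⟨i, ?_⟩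
        have : i ≠ (Nat.unpair l).1 := by
          rintro rfl
          exact hi hm
        dsimp only
        rw [if_neg this]
        exact fun h => hi (Set.mem_iInter.1 h m)
      · refine ⟨(Nat.unpair l).1, ?_⟩
        simpa using hx
  let T := {p : ℕ × (ℕ → ℕ) // ¬ NovSep (fun i => g i '' cylinder p.2 p.1)}
  have : ∀ p : T, ∃ q : T, q.1.1 = p.1.1 + 1 ∧ q.1.2 ∈ cylinder p.1.2 p.1.1 := by
    rintro ⟨⟨l, w⟩, hp⟩
    obtain ⟨w', hw', h'⟩ := step l w hp
    exact ⟨⟨(l + 1, w'), h'⟩, rfl, hw'⟩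
  choose F hFn hFx using this
  have h0 : ¬ NovSep (fun i => g i '' cylinder (fun _ => 0) 0) := by
    rintro ⟨B, h1, h2, h3⟩
    refine hns ⟨B, h1, fun i => ?_, h3⟩
    rintro _ ⟨v, rfl⟩
    refine h2 i ⟨fun j => v (Nat.unpair j).2, by simp, ?_⟩
    simp [g]
  let p : ℕ → T := fun l => F^[l] ⟨(0, fun _ => 0), h0⟩
  have prec : ∀ l, p (l + 1) = F (p l) := fun l => by
    simp only [p, Function.iterate_succ', Function.comp]
  have pfst : ∀ l, (p l).1.1 = l := fun l => by
    induction l with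
    | zero => rfl
    | succ l IH => rw [prec, hFn, IH]
  have Ix : ∀ m l, m + 1 ≤ l → (p l).1.2 m = (p (m + 1)).1.2 m := by
    intro m
    apply Nat.le_induction
    · rfl
    intro l hml IH
    have I : (F (p l)).1.2 m = (p l).1.2 m := by
      apply hFx (p l) m
      rw [pfst]
      exact hml
    rw [prec, I, IH]
  set w : ℕ → ℕ := fun l => (p (l + 1)).1.2 l with hw
  have M : ∀ l, ¬ NovSep (fun i => g i '' cylinder w l) := by
    intro l
    have hc : cylinder w l = cylinder (p l).1.2 (p l).1.1 := by
      rw [pfst, ← mem_cylinder_iff_eq, mem_cylinder_iff]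
      intro i hi
      rw [hw]
      exact (Ix i l hi).symm
    rw [hc]
    exact (p l).2
  obtain ⟨i, hi⟩ := h (g 0 w)
  have hne : g i w ≠ g 0 w := fun he => hi (he ▸ ⟨_, rfl⟩)
  obtain ⟨u, v, hu, hv, hiu, h0v, huv⟩ := t2_separation hne
  have near : ∀ (j : ℕ) (u : Set X), IsOpen u → g j w ∈ u →
      ∃ l, g j '' cylinder w l ⊆ u := by
    intro j u hu hj
    let : MetricSpace (ℕ → ℕ) := metricSpaceNatNat
    obtain ⟨ε, εpos, hε⟩ : ∃ (ε : ℝ), ε > 0 ∧ Metric.ball w ε ⊆ g j ⁻¹' u :=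
      Metric.mem_nhds_iff.1 ((hg j).continuousAt.preimage_mem_nhds (hu.mem_nhds hj))
    obtain ⟨l, hl⟩ : ∃ l : ℕ, (1 / 2 : ℝ) ^ l < ε :=
      exists_pow_lt_of_lt_one εpos (by norm_num)
    refine ⟨l, ?_⟩
    rw [Set.image_subset_iff]
    refine Set.Subset.trans ?_ hε
    intro z hz
    rw [mem_cylinder_iff_dist_le] at hz
    exact hz.trans_lt hl
  obtain ⟨l1, h1⟩ := near i u hu hiu
  obtain ⟨l2, h2⟩ := near 0 v hv h0v
  have hi0 : i ≠ 0 := by rintro rfl; exact hne rfl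
  refine M (max l1 l2) ⟨fun j => if j = i then u else if j = 0 then v else Set.univ, ?_, ?_, ?_⟩
  · intro j
    dsimp only
    split_ifs
    · exact hu.measurableSet
    · exact hv.measurableSet
    · exact MeasurableSet.univ
  · intro j
    dsimp only
    split_ifs with ha hb
    · subst ha
      exact (Set.image_mono (cylinder_anti _ (le_max_left _ _))).trans h1
    · subst hb
      exact (Set.image_mono (cylinder_anti _ (le_max_right _ _))).trans h2
    · exact Set.subset_univ _
  · intro x
    by_cases hx : x ∈ u
    · exact ⟨0, by simpa [hi0.symm] using Set.disjoint_left.1 huv hx⟩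
    · exact ⟨i, by simpa using hx⟩

theorem novSep_analytic {X : Type*} [TopologicalSpace X] [T2Space X] [MeasurableSpace X]
    [OpensMeasurableSpace X] (A : ℕ → Set X) (hA : ∀ i, MeasureTheory.AnalyticSet (A i))
    (h : ∀ x, ∃ i, x ∉ A i) : NovSep A := by
  by_cases he : ∃ i, A i = ∅
  · obtain ⟨i, hi⟩ := he
    refine ⟨fun j => if j = i then ∅ else Set.univ, ?_, ?_, fun x => ⟨i, by simp⟩⟩
    · intro j
      dsimp only
      split_ifs <;> simp
    · intro j
      dsimp only
      split_ifs with hj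
      · subst hj; exact hi.subset
      · exact Set.subset_univ _
  · have : ∀ i, ∃ f : (ℕ → ℕ) → X, Continuous f ∧ Set.range f = A i := by
      intro i
      have := hA i
      rw [MeasureTheory.AnalyticSet] at this
      exact this.resolve_left fun hi => he ⟨i, hi⟩
    choose f hf hfA using this
    have := novSep_range f hf (by simpa only [hfA] using h)
    simpa only [hfA] using this

/-- A finite Borel equivalence relation admits a countable cover by Borel partial
transversals. -/
theorem exists_partial_transversals {X : Type*} [MeasurableSpace X] [StandardBorelSpace X]
    (F : X → X → Prop) (hFB : MeasurableSet {p : X × X | F p.1 p.2})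
    (hfin : ∀ x, {y | F x y}.Finite) :
    ∃ B : ℕ → Set X, (∀ j, MeasurableSet (B j)) ∧ (∀ x, ∃ j, x ∈ B j) ∧
      ∀ j, ∀ x ∈ B j, ∀ y ∈ B j, F x y → x = y := by
  let := upgradeStandardBorel X
  obtain ⟨b, hbc, -, hb⟩ := TopologicalSpace.exists_countable_basis X
  obtain ⟨W, hW⟩ : ∃ W : ℕ → Set X, insert ∅ b = Set.range W :=
    (hbc.insert ∅).exists_eq_range (Set.insert_nonempty _ _)
  have hWo : ∀ j, IsOpen (W j) := by
    intro j
    have : W j ∈ insert ∅ b := hW ▸ ⟨j, rfl⟩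
    rcases this with h | h
    · rw [h]; exact isOpen_empty
    · exact hb.isOpen h
  let R : ℕ → Set (X × X) := fun j =>
    {p | p.1 ∉ W j} ∪ ({p | F p.1 p.2} ∩ {p | p.1 ≠ p.2} ∩ {p | p.2 ∈ W j})
  have hR : ∀ j, MeasurableSet (R j) := by
    intro j
    refine MeasurableSet.union ?_ ((hFB.inter ?_).inter ?_)
    · exact measurable_fst (hWo j).measurableSet.compl
    · exact (measurableSet_eq_fun measurable_fst measurable_snd).compl
    · exact measurable_snd (hWo j).measurableSet
  obtain ⟨D, hDm, hDs, hDe⟩ := novSep_analytic (fun j => Prod.fst '' R j)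
    (fun j => (hR j).analyticSet.image_of_continuous continuous_fst) (by
      intro x
      have hcl : IsClosed ({y | F x y} \ {x}) := ((hfin x).subset Set.sdiff_subset).isClosed
      obtain ⟨V, hV, hxV, hVs⟩ := hb.exists_subset_of_mem_open
        (show x ∈ ({y | F x y} \ {x})ᶜ by simp) hcl.isOpen_compl
      obtain ⟨j, rfl⟩ : V ∈ Set.range W := hW ▸ Or.inr hV
      refine ⟨j, ?_⟩
      rintro ⟨⟨x', y⟩, h, rfl⟩
      rcases h with h | ⟨⟨h1, h2⟩, h3⟩
      · exact h hxV
      · exact hVs h3 ⟨h1, fun h => h2 h.symm⟩)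
  refine ⟨fun j => (D j)ᶜ, fun j => (hDm j).compl, hDe, ?_⟩
  intro j x hx y hy hxy
  by_contra hne
  have hyW : y ∈ W j := by
    by_contra hyW
    exact hy (hDs j ⟨(y, y), Or.inl hyW, rfl⟩)
  exact hx (hDs j ⟨(x, y), Or.inr ⟨⟨hxy, hne⟩, hyW⟩, rfl⟩)

/-- Enumeration of classes and Borel representatives for a finite Borel equivalence relation. -/
theorem exists_enum_finite {X : Type*} [MeasurableSpace X] [StandardBorelSpace X]
    (F : X → X → Prop) (hF : Equivalence F) (hFB : MeasurableSet {p : X × X | F p.1 p.2})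
    (hfin : ∀ x, {y | F x y}.Finite) :
    ∃ (g : ℕ → X → X) (r : X → X), (∀ j, Measurable (g j)) ∧ (∀ j x, F x (g j x)) ∧
      (∀ x y, F x y → ∃ j, g j x = y) ∧ Measurable r ∧ (∀ x, F x (r x)) ∧
      (∀ x y, F x y → r x = r y) := by
  obtain ⟨B, hBm, hBc, hBi⟩ := exists_partial_transversals F hFB hfin
  let D : ℕ → Set X := fun j => {x | ∃ y ∈ B j, F x y}
  have huniq : ∀ j x y y', y ∈ B j → F x y → y' ∈ B j → F x y' → y = y' :=
    fun j x y y' h1 h2 h3 h4 => hBi j y h1 y' h3 (hF.trans (hF.symm h2) h4)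
  have hproj : ∀ j (T : Set X), MeasurableSet T →
      MeasurableSet {x | ∃ y, y ∈ B j ∧ y ∈ T ∧ F x y} := by
    intro j T hT
    have : {x | ∃ y, y ∈ B j ∧ y ∈ T ∧ F x y} =
        Prod.fst '' ({p : X × X | F p.1 p.2} ∩ Prod.snd ⁻¹' (B j ∩ T)) := by
      ext x
      constructor
      · rintro ⟨y, h1, h2, h3⟩
        exact ⟨(x, y), ⟨h3, h1, h2⟩, rfl⟩
      · rintro ⟨⟨x', y⟩, ⟨h3, h1, h2⟩, rfl⟩
        exact ⟨y, h1, h2, h3⟩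
    rw [this]
    refine (hFB.inter (measurable_snd ((hBm j).inter hT))).image_of_measurable_injOn
      measurable_fst ?_
    rintro ⟨x, y⟩ ⟨h1, h2, -⟩ ⟨x', y'⟩ ⟨h1', h2', -⟩ h
    obtain rfl : x = x' := h
    exact Prod.ext rfl (huniq j x y y' h2 h1 h2' h1')
  have hD : ∀ j, MeasurableSet (D j) := by
    intro j
    convert hproj j Set.univ MeasurableSet.univ using 1
    ext x; simp [D]
  let g : ℕ → X → X := fun j x => if h : ∃ y ∈ B j, F x y then h.choose else x
  have hg1 : ∀ j x y, y ∈ B j → F x y → g j x = y := by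
    intro j x y hy hxy
    have h : ∃ y ∈ B j, F x y := ⟨y, hy, hxy⟩
    simp only [g, dif_pos h]
    exact huniq j x _ _ h.choose_spec.1 h.choose_spec.2 hy hxy
  have hg2 : ∀ j x, x ∉ D j → g j x = x := by
    intro j x hx
    exact dif_neg hx
  have hgF : ∀ j x, F x (g j x) := by
    intro j x
    by_cases h : x ∈ D j
    · obtain ⟨y, hy, hxy⟩ := h
      rw [hg1 j x y hy hxy]; exact hxy
    · rw [hg2 j x h]; exact hF.refl x
  have hgm : ∀ j, Measurable (g j) := by
    intro j T hT
    have : g j ⁻¹' T = {x | ∃ y, y ∈ B j ∧ y ∈ T ∧ F x y} ∪ ((D j)ᶜ ∩ T) := by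
      ext x
      by_cases h : x ∈ D j
      · have h' := h
        obtain ⟨y, hy, hxy⟩ := h
        simp only [Set.mem_preimage, hg1 j x y hy hxy, Set.mem_union, Set.mem_ofPred_eq,
          Set.mem_inter_iff, Set.mem_compl_iff, h', not_true, false_and, or_false]
        constructor
        · intro hT; exact ⟨y, hy, hT, hxy⟩
        · rintro ⟨y', h1, h2, h3⟩
          rwa [huniq j x y y' hy hxy h1 h3]
      · simp only [Set.mem_preimage, hg2 j x h, Set.mem_union, Set.mem_ofPred_eq,
          Set.mem_inter_iff, Set.mem_compl_iff, h, not_false_iff, true_and]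
        constructor
        · exact Or.inr
        · rintro (⟨y', h1, h2, h3⟩ | h')
          · exact absurd ⟨y', h1, h3⟩ h
          · exact h'
    rw [this]
    exact (hproj j T hT).union ((hD j).compl.inter hT)
  have hex : ∀ x, ∃ j, x ∈ D j := fun x => by
    obtain ⟨j, hj⟩ := hBc x
    exact ⟨j, x, hj, hF.refl x⟩
  refine ⟨g, fun x => g (Nat.find (hex x)) x, hgm, hgF, ?_, ?_, fun x => hgF _ x, ?_⟩
  · intro x y hxy
    obtain ⟨j, hj⟩ := hBc y
    exact ⟨j, hg1 j x y hj hxy⟩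
  · exact Measurable.find (p := fun j x => x ∈ D j) hgm hD hex
  · intro x y hxy
    have hDD : ∀ j, x ∈ D j ↔ y ∈ D j := fun j =>
      ⟨fun ⟨z, hz, h⟩ => ⟨z, hz, hF.trans (hF.symm hxy) h⟩,
        fun ⟨z, hz, h⟩ => ⟨z, hz, hF.trans hxy h⟩⟩
    have hfind : Nat.find (hex x) = Nat.find (hex y) := by
      simp only [hDD]
    dsimp only
    rw [hfind]
    obtain ⟨z, hz, hyz⟩ := Nat.find_spec (hex y)
    rw [hg1 _ y z hz hyz, hg1 _ x z hz (hF.trans hxy hyz)]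

/-- `z` extends `P` in the color `a`. -/
def GoodPt {X : Type*} (n : ℕ) {k : ℕ} (c : Finset X → Fin k) (a : ℕ) (P : Set X) (z : X) : Prop :=
  z ∉ P ∧ ∀ A : Finset X, A.card = n → z ∈ A → ↑A ⊆ insert z P → (c A).val = a

theorem GoodPt.mono {X : Type*} {n k : ℕ} {c : Finset X → Fin k} {a : ℕ} {P Q : Set X} {z : X}
    (h : GoodPt n c a Q z) (hPQ : P ⊆ Q) : GoodPt n c a P z :=
  ⟨fun hz => h.1 (hPQ hz), fun A h1 h2 h3 =>
    h.2 A h1 h2 (h3.trans (Set.insert_subset_insert hPQ))⟩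

theorem measurableSet_goodPt {X : Type*} [MeasurableSpace X] [StandardBorelSpace X]
    (E : X → X → Prop) (g : ℕ → X → X) (hgm : ∀ j, Measurable (g j))
    (hgs : ∀ x y, E x y → ∃ j, g j x = y) (hgE : ∀ j x, E x (g j x))
    (n k : ℕ) (c : Finset X → Fin k) (hcBorel : IsBorelColoring n c) (a l : ℕ)
    (R : X → X → Prop) (hR : MeasurableSet {p : X × X | R p.1 p.2}) (hRE : ∀ x y, R x y → E x y) :
    MeasurableSet {x | GoodPt n c a {y | R x y} (g l x)} := by
  have hEq : ∀ i j, MeasurableSet {x | g i x = g j x} :=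
    fun i j => measurableSet_eq_fun (hgm i) (hgm j)
  have hRg : ∀ j, MeasurableSet {x | R x (g j x)} :=
    fun j => (measurable_id.prodMk (hgm j)) hR
  have hc : ∀ v : Fin n → ℕ, MeasurableSet
      {x | (c (Set.finite_range (fun i => g (v i) x)).toFinset).val = a} := by
    intro v
    have h1 : Measurable fun x => c (Set.finite_range (fun i => g (v i) x)).toFinset :=
      hcBorel.comp (measurable_pi_lambda (fun x i => g (v i) x) fun i => hgm (v i))
    exact h1 (Set.to_countable {b : Fin k | b.val = a}).measurableSet
  have key : {x | GoodPt n c a {y | R x y} (g l x)} =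
      {x | R x (g l x)}ᶜ ∩ ⋂ v : Fin n → ℕ,
        ((⋂ i, ⋂ j, ⋂ _ : i ≠ j, {x | g (v i) x = g (v j) x}ᶜ) ∩
          (⋃ i, {x | g (v i) x = g l x}) ∩
          (⋂ i, ({x | g (v i) x = g l x} ∪ {x | R x (g (v i) x)})))ᶜ ∪
        {x | (c (Set.finite_range (fun i => g (v i) x)).toFinset).val = a} := by
    ext x
    constructor
    · rintro ⟨h1, h2⟩
      refine ⟨h1, Set.mem_iInter.2 fun v => ?_⟩
      by_contra hcon
      rw [Set.mem_union, not_or, Set.notMem_compl_iff] at hcon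
      obtain ⟨⟨⟨hinj, hz⟩, hsub⟩, hne⟩ := hcon
      simp only [Set.mem_iInter] at hinj
      simp only [Set.mem_iUnion] at hz
      simp only [Set.mem_iInter] at hsub
      apply hne
      apply h2
      · have hi : Function.Injective fun i => g (v i) x := by
          intro i j hij
          by_contra hne
          exact hinj i j hne hij
        rw [← Set.ncard_eq_toFinset_card _ (Set.finite_range _), ← Set.image_univ,
          Set.ncard_image_of_injective _ hi]
        simp
      · simpa using hz
      · rw [Set.Finite.coe_toFinset]
        rintro _ ⟨i, rfl⟩
        exact hsub i
    · rintro ⟨h1, h2⟩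
      refine ⟨h1, fun A hA hz hsub => ?_⟩
      have hAE : ∀ y ∈ A, E x y := by
        intro y hy
        rcases hsub hy with rfl | h
        · exact hgE l x
        · exact hRE x y h
      let e := (Finset.equivFinOfCardEq hA).symm
      choose v hv using fun i => hgs x (e i).1 (hAE _ (e i).2)
      have hfun : (fun i => g (v i) x) = fun i => (e i).1 := funext hv
      have hrange : (Set.finite_range (fun i => g (v i) x)).toFinset = A := by
        ext y
        rw [Set.Finite.mem_toFinset, hfun]
        constructor
        · rintro ⟨i, rfl⟩; exact (e i).2
        · intro hy; exact ⟨e.symm ⟨y, hy⟩, by simp⟩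
      have h3 := Set.mem_iInter.1 h2 v
      rcases h3 with h3 | h3
      · exfalso
        apply h3
        refine ⟨⟨?_, ?_⟩, ?_⟩
        · simp only [Set.mem_iInter]
          intro i j hij h
          have h' : g (v i) x = g (v j) x := h
          rw [hv, hv] at h'
          exact hij (e.injective (Subtype.ext h'))
        · refine Set.mem_iUnion.2 ⟨e.symm ⟨_, hz⟩, ?_⟩
          change g (v _) x = g l x
          rw [hv]; simp
        · refine Set.mem_iInter.2 fun i => ?_
          have : g (v i) x ∈ A := by rw [hv]; exact (e i).2
          exact hsub this
      · have h4 : (c (Set.finite_range (fun i => g (v i) x)).toFinset).val = a := h3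
        rwa [hrange] at h4
  rw [key]
  refine (hRg l).compl.inter (MeasurableSet.iInter fun v => MeasurableSet.union ?_ (hc v))
  refine MeasurableSet.compl (MeasurableSet.inter (MeasurableSet.inter ?_ ?_) ?_)
  · exact MeasurableSet.iInter fun i => MeasurableSet.iInter fun j => MeasurableSet.iInter fun _ =>
      (hEq _ _).compl
  · exact MeasurableSet.iUnion fun i => hEq _ _
  · exact MeasurableSet.iInter fun i => (hEq _ _).union (hRg _)

/-- `a` is a color at infinity for the class of `x`. -/
def IsCol {X : Type*} (E : X → X → Prop) (n : ℕ) {k : ℕ} (c : Finset X → Fin k) (a : ℕ)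
    (x : X) : Prop :=
  ∀ P : Set X, P.Finite → (∀ y ∈ P, E x y) → ∃ z, E x z ∧ GoodPt n c a P z

theorem exists_isCol {X : Type*} (E : X → X → Prop) (hE : Equivalence E)
    (haper : ∀ x : X, {y | E x y}.Infinite) (n k : ℕ) (hn : 1 < n)
    (c : Finset X → Fin k) (hcat : AlmostTransitive E n c) (x : X) :
    ∃ a, IsCol E n c a x := by
  obtain ⟨B0, hB0, hB0c⟩ := (haper x).exists_subset_card_eq (n - 1)
  have hB0E : ∀ y ∈ B0, E x y := fun y hy => hB0 hy
  have hfin : ∃ a : Fin k, {z | E x z ∧ z ∉ B0 ∧ c (insert z B0) = a}.Infinite := by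
    by_contra hcon
    push Not at hcon
    refine haper x (((Set.finite_iUnion hcon).union B0.finite_toSet).subset ?_)
    intro z hz
    by_cases hzB : z ∈ B0
    · exact Or.inr hzB
    · exact Or.inl (Set.mem_iUnion.2 ⟨_, hz, hzB, rfl⟩)
  obtain ⟨a, ha⟩ := hfin
  refine ⟨a.val, fun P hP hPE => ?_⟩
  let bad : Finset X → Set X := fun B =>
    {z | E x z ∧ z ∉ B ∪ B0 ∧ c (insert z B) ≠ c (insert z B0)}
  have hbad : ∀ B : Finset X, B.card = n - 1 → (∀ y ∈ B, E x y) → (bad B).Finite := by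
    intro B hB hBE
    by_cases hBB : B = B0
    · subst hBB
      convert Set.finite_empty
      ext z
      simp [bad]
    · have hcard : n ≤ (B ∪ B0).card := by
        by_contra hlt
        have h1 : B = B ∪ B0 := Finset.eq_of_subset_of_card_le Finset.subset_union_left (by omega)
        have h2 : B0 = B ∪ B0 :=
          Finset.eq_of_subset_of_card_le Finset.subset_union_right (by omega)
        exact hBB (h1.trans h2.symm)
      have hUE : ∀ y ∈ B ∪ B0, E x y := by
        intro y hy
        rcases Finset.mem_union.1 hy with h | h
        · exact hBE y h
        · exact hB0E y h
      refine (hcat _ hcard (B ∪ B0) rfl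
        (fun y hy z hz => hE.trans (hE.symm (hUE y hy)) (hUE z hz)) B B0
        Finset.subset_union_left Finset.subset_union_right hB hB0c).subset ?_
      rintro z ⟨h1, h2, h3⟩
      obtain ⟨b, hb⟩ : (B ∪ B0).Nonempty := Finset.card_pos.1 (by omega)
      exact ⟨⟨b, hb, hE.trans (hE.symm (hUE b hb)) h1⟩, h2, h3⟩
  have hbadU : (⋃ B ∈ Finset.powersetCard (n - 1) hP.toFinset, bad B).Finite := by
    refine Set.Finite.biUnion (Finset.finite_toSet _) fun B hB => ?_
    have hB' := Finset.mem_powersetCard.1 hB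
    exact hbad B hB'.2 fun y hy => hPE y (by simpa using hB'.1 hy)
  obtain ⟨z, ⟨hz1, hz2, hz3⟩, hz4⟩ := (ha.sdiff (hP.union hbadU)).nonempty
  rw [Set.mem_union, not_or] at hz4
  refine ⟨z, hz1, hz4.1, fun A hA hzA hsub => ?_⟩
  have hBP : A.erase z ⊆ hP.toFinset := by
    intro y hy
    rw [Finset.mem_erase] at hy
    rw [Set.Finite.mem_toFinset]
    exact (hsub hy.2).resolve_left hy.1
  have hBc : (A.erase z).card = n - 1 := by rw [Finset.card_erase_of_mem hzA, hA]
  have h5 : z ∉ bad (A.erase z) := fun h =>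
    hz4.2 (Set.mem_biUnion (show A.erase z ∈ _ from Finset.mem_powersetCard.2 ⟨hBP, hBc⟩) h)
  have h6 : c (insert z (A.erase z)) = c (insert z B0) := by
    by_contra hne
    exact h5 ⟨hz1, by simpa using hz2, hne⟩
  rw [Finset.insert_erase hzA, hz3] at h6
  rw [h6]

theorem monochromatic_reduction_aux
    {X : Type*} [MeasurableSpace X] [StandardBorelSpace X]
    (E : X → X → Prop) (hE : Equivalence E)
    (haper : ∀ x : X, {y | E x y}.Infinite)
    (F : ℕ → X → X → Prop)
    (hF : ∀ i, Equivalence (F i))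
    (hFB : ∀ i, MeasurableSet {p : X × X | F i p.1 p.2})
    (hFf : ∀ i, ∀ x : X, {y | F i x y}.Finite)
    (hFm : ∀ i, ∀ x y : X, F i x y → F (i + 1) x y)
    (hFE : ∀ x y : X, E x y ↔ ∃ i, F i x y)
    (n k : ℕ) (hn : 1 < n)
    (c : Finset X → Fin k) (hcBorel : IsBorelColoring n c)
    (hcat : AlmostTransitive E n c) :
    ∃ S : X → ℕ → X, Measurable S ∧ IsMonochromaticReduction E n c S := by
  choose g0 r hg0m hg0F hg0s hrm hrF hrinv using
    fun i => exists_enum_finite (F i) (hF i) (hFB i) (hFf i)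
  -- enumeration of the `E`-classes
  obtain ⟨g, hgm, hgE, hgs⟩ : ∃ g : ℕ → X → X, (∀ j, Measurable (g j)) ∧
      (∀ j x, E x (g j x)) ∧ ∀ x y, E x y → ∃ j, g j x = y := by
    refine ⟨fun j => g0 j.unpair.1 j.unpair.2, fun j => hg0m _ _,
      fun j x => (hFE _ _).2 ⟨_, hg0F _ _ x⟩, fun x y hxy => ?_⟩
    obtain ⟨i, hi⟩ := (hFE x y).1 hxy
    obtain ⟨j, hj⟩ := hg0s i x y hi
    exact ⟨Nat.pair i j, by simpa using hj⟩
  -- the invariant color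
  have hcol := exists_isCol E hE haper n k hn c hcat
  have hcolm : ∀ a, MeasurableSet {x | IsCol E n c a x} := by
    intro a
    have : {x | IsCol E n c a x} =
        ⋂ N : ℕ, ⋃ l : ℕ, {x | GoodPt n c a {y | ∃ j : Fin N, y = g j x} (g l x)} := by
      ext x
      simp only [Set.mem_iInter, Set.mem_iUnion]
      constructor
      · intro h N
        obtain ⟨z, hz, hgood⟩ := h {y | ∃ j : Fin N, y = g j x}
          ((Set.finite_range fun j : Fin N => g j x).subset
            (by rintro _ ⟨j, rfl⟩; exact ⟨j, rfl⟩))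
          (by rintro _ ⟨j, rfl⟩; exact hgE _ _)
        obtain ⟨l, rfl⟩ := hgs x z hz
        exact ⟨l, hgood⟩
      · intro h P hP hPE
        have : ∃ N : ℕ, P ⊆ {y | ∃ j : Fin N, y = g j x} := by
          choose! f hf using fun y hy => hgs x y (hPE y hy)
          obtain ⟨N, hN⟩ := (hP.image f).bddAbove
          exact ⟨N + 1, fun y hy => ⟨⟨f y, Nat.lt_succ_of_le (hN ⟨y, hy, rfl⟩)⟩,
            (hf y hy).symm⟩⟩
        obtain ⟨N, hN⟩ := this
        obtain ⟨l, hl⟩ := h N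
        exact ⟨g l x, hgE l x, GoodPt.mono hl hN⟩
    rw [this]
    refine MeasurableSet.iInter fun N => MeasurableSet.iUnion fun l => ?_
    refine measurableSet_goodPt E g hgm hgs hgE n k c hcBorel a l
      (fun x y => ∃ j : Fin N, y = g j x) ?_ ?_
    · have : {p : X × X | ∃ j : Fin N, p.2 = g j p.1} =
          ⋃ j : Fin N, {p : X × X | p.2 = g j p.1} := by
        ext p; simp
      rw [this]
      exact MeasurableSet.iUnion fun j =>
        measurableSet_eq_fun measurable_snd ((hgm j).comp measurable_fst)
    · rintro x _ ⟨j, rfl⟩; exact hgE _ _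
  have hcolinv : ∀ a x y, E x y → (IsCol E n c a x → IsCol E n c a y) := by
    intro a x y hxy h P hP hPE
    obtain ⟨z, hz, hgood⟩ := h P hP fun u hu => hE.trans hxy (hPE u hu)
    exact ⟨z, hE.trans (hE.symm hxy) hz, hgood⟩
  let a : X → ℕ := fun x => Nat.find (hcol x)
  have ham : Measurable a := measurable_find hcol hcolm
  have hacol : ∀ x, IsCol E n c (a x) x := fun x => Nat.find_spec (hcol x)
  have hainv : ∀ x y, E x y → a x = a y := by
    intro x y hxy
    have : ∀ b, IsCol E n c b x ↔ IsCol E n c b y :=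
      fun b => ⟨hcolinv b x y hxy, hcolinv b y x (hE.symm hxy)⟩
    simp only [a, this]
  -- one step of the recursion
  let Inv : (X → Set X) → Prop := fun H =>
    MeasurableSet {p : X × X | p.2 ∈ H p.1} ∧ (∀ x, (H x).Finite) ∧ ∀ x, ∀ y ∈ H x, E x y
  have hFsub : ∀ i x y, F i x y → E x y := fun i x y h => (hFE x y).2 ⟨i, h⟩
  have step : ∀ (i : ℕ) (H : {H : X → Set X // Inv H}), ∃ s : X → X, Measurable s ∧
      (∀ x, E x (s x)) ∧ (∀ x y, F i x y → s x = s y) ∧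
      ∀ x, GoodPt n c (a x) {y | ∃ u, F i x u ∧ y ∈ H.1 u} (s x) := by
    rintro i ⟨H, hHm, hHf, hHE⟩
    let R : X → X → Prop := fun x y => ∃ u, F i x u ∧ y ∈ H u
    have hRE : ∀ x y, R x y → E x y := by
      rintro x y ⟨u, hu, hy⟩
      exact hE.trans (hFsub i x u hu) (hHE u y hy)
    have hRm : MeasurableSet {p : X × X | R p.1 p.2} := by
      have : {p : X × X | R p.1 p.2} =
          ⋃ j, {p : X × X | p.2 ∈ H (g0 i j p.1)} := by
        ext ⟨x, y⟩
        simp only [Set.mem_iUnion]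
        constructor
        · rintro ⟨u, hu, hy⟩
          obtain ⟨j, rfl⟩ := hg0s i x u hu
          exact ⟨j, hy⟩
        · rintro ⟨j, hj⟩
          exact ⟨_, hg0F i j x, hj⟩
      rw [this]
      exact MeasurableSet.iUnion fun j =>
        (((hg0m i j).comp measurable_fst).prodMk measurable_snd) hHm
    have hRf : ∀ x, {y | R x y}.Finite := by
      intro x
      refine ((hFf i x).biUnion fun u _ => hHf u).subset ?_
      rintro y ⟨u, hu, hy⟩
      exact Set.mem_biUnion (show u ∈ {y | F i x y} from hu) hy
    have hex : ∀ x, ∃ l, GoodPt n c (a x) {y | R x y} (g l x) := by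
      intro x
      obtain ⟨z, hz, hgood⟩ := hacol x {y | R x y} (hRf x) fun y hy => hRE x y hy
      obtain ⟨l, rfl⟩ := hgs x z hz
      exact ⟨l, hgood⟩
    have hgoodm : ∀ l, MeasurableSet {x | GoodPt n c (a x) {y | R x y} (g l x)} := by
      intro l
      have : {x | GoodPt n c (a x) {y | R x y} (g l x)} =
          ⋃ b : ℕ, (a ⁻¹' {b} ∩ {x | GoodPt n c b {y | R x y} (g l x)}) := by
        ext x
        simp only [Set.mem_iUnion]
        constructor
        · intro h; exact ⟨a x, rfl, h⟩
        · rintro ⟨b, hb, h⟩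
          have hb' : a x = b := hb
          subst hb'
          exact h
      rw [this]
      exact MeasurableSet.iUnion fun b => (ham (measurableSet_singleton b)).inter
        (measurableSet_goodPt E g hgm hgs hgE n k c hcBorel b l R hRm hRE)
    let t : X → X := fun x => g (Nat.find (hex x)) x
    have htm : Measurable t :=
      Measurable.find (p := fun l x => GoodPt n c (a x) {y | R x y} (g l x)) hgm hgoodm hex
    refine ⟨fun x => t (r i x), htm.comp (hrm i), fun x => ?_, fun x y hxy => ?_, fun x => ?_⟩
    · exact hE.trans (hFsub i _ _ (hrF i x)) (hgE _ _)
    · exact congrArg t (hrinv i x y hxy)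
    · have h1 : GoodPt n c (a (r i x)) {y | R (r i x) y} (t (r i x)) := Nat.find_spec (hex (r i x))
      rw [← hainv x (r i x) (hFsub i _ _ (hrF i x))] at h1
      refine h1.mono ?_
      rintro y ⟨u, hu, hy⟩
      exact ⟨u, (hF i).trans ((hF i).symm (hrF i x)) hu, hy⟩
  choose s hsm hsE hsinv hsgood using step
  have hnext : ∀ (i : ℕ) (H : {H : X → Set X // Inv H}),
      Inv fun x => insert (s i H x) (H.1 x) := by
    rintro i H
    refine ⟨?_, fun x => (H.2.2.1 x).insert _, ?_⟩
    · have : {p : X × X | p.2 ∈ insert (s i H p.1) (H.1 p.1)} =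
          {p : X × X | p.2 = s i H p.1} ∪ {p : X × X | p.2 ∈ H.1 p.1} := by
        ext p; exact Iff.rfl
      rw [this]
      exact (measurableSet_eq_fun measurable_snd ((hsm i H).comp measurable_fst)).union H.2.1
    · rintro x y (rfl | hy)
      · exact hsE i H x
      · exact H.2.2.2 x y hy
  have hInv0 : Inv fun _ => ∅ := by
    refine ⟨?_, fun x => Set.finite_empty, fun x y hy => hy.elim⟩
    have : {p : X × X | p.2 ∈ (∅ : Set X)} = ∅ := by ext p; exact Iff.rfl
    rw [this]
    exact MeasurableSet.empty
  let HH : ℕ → {H : X → Set X // Inv H} := fun i =>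
    Nat.rec ⟨fun _ => ∅, hInv0⟩ (fun i H => ⟨fun x => insert (s i H x) (H.1 x), hnext i H⟩) i
  let S : X → ℕ → X := fun x i => s i (HH i) x
  have hmem : ∀ x j i, j < i → S x j ∈ (HH i).1 x := by
    intro x j i hji
    induction i with
    | zero => omega
    | succ i ih =>
      change S x j ∈ insert (S x i) ((HH i).1 x)
      by_cases h : j = i
      · subst h; exact Set.mem_insert _ _
      · exact Set.mem_insert_of_mem _ (ih (by omega))
  have hgood : ∀ x i, GoodPt n c (a x) ((HH i).1 x) (S x i) := by
    intro x i
    exact (hsgood i (HH i) x).mono fun y hy => ⟨x, (hF i).refl x, hy⟩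
  have hlt : ∀ x i j, j < i → S x j ≠ S x i := by
    intro x i j hji he
    exact (hgood x i).1 (he ▸ hmem x j i hji)
  have hSE : ∀ x i, E x (S x i) := fun x i => hsE i _ x
  refine ⟨S, measurable_pi_lambda _ fun i => hsm i (HH i), ?_, ?_, ?_⟩
  · intro x i j hij
    rcases lt_trichotomy i j with h | h | h
    · exact absurd hij (hlt x j i h)
    · exact h
    · exact absurd hij.symm (hlt x i j h)
  · intro x
    refine ⟨hSE x, ?_⟩
    have hval : ∀ A : Finset X, A.card = n → ↑A ⊆ Set.range (S x) → (c A).val = a x := by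
      intro A hA hsub
      choose! f hf using fun y (hy : y ∈ A) => hsub hy
      obtain ⟨z, hzA, hz⟩ := A.exists_max_image f (Finset.card_pos.1 (by omega))
      have hzz := hf z hzA
      have hg := hgood x (f z)
      rw [hzz] at hg
      refine hg.2 A hA hzA fun y hy => ?_
      have hy' : y ∈ A := hy
      rcases (hz y hy').lt_or_eq with h | h
      · right
        rw [← hf y hy']
        exact hmem x _ _ h
      · left
        rw [← hf y hy', h, hzz]
    have hinfi : (Set.range (S x)).Infinite := by
      refine Set.infinite_range_of_injective ?_
      intro i j hij
      rcases lt_trichotomy i j with h | h | h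
      · exact absurd hij (hlt x j i h)
      · exact h
      · exact absurd hij.symm (hlt x i j h)
    obtain ⟨A0, hA0, hA0c⟩ := hinfi.exists_subset_card_eq n
    refine ⟨c A0, fun A hA hsub => Fin.ext ?_⟩
    rw [hval A hA hsub, hval A0 hA0c hA0]
  · intro x y
    constructor
    · intro hxy
      obtain ⟨i, hi⟩ := (hFE x y).1 hxy
      refine ⟨i, fun j hj => hsinv j (HH j) x y ?_⟩
      exact Nat.le_induction hi (fun m _ h => hFm m x y h) j hj
    · rintro ⟨N, hN⟩
      have := hN N le_rfl
      exact hE.trans (hSE x N) (this ▸ hE.symm (hSE y N))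

/-- For an aperiodic hyperfinite Borel equivalence relation `E` and integers `n, k > 1`,
every Borel almost transitive `E`-coloring of dimension `n` by `k` colors admits a Borel
monochromatic reduction to `E₁`. -/
theorem monochromatic_reduction_for_hyperfinite
    {X : Type*} [MeasurableSpace X] [StandardBorelSpace X]
    (E : X → X → Prop) (hE : Equivalence E)
    (hEBorel : MeasurableSet {p : X × X | E p.1 p.2})
    (haper : ∀ x : X, {y | E x y}.Infinite)
    (hhyperfinite : ∃ F : ℕ → X → X → Prop,
      (∀ i, Equivalence (F i)) ∧
      (∀ i, MeasurableSet {p : X × X | F i p.1 p.2}) ∧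
      (∀ i, ∀ x : X, {y | F i x y}.Finite) ∧
      (∀ i, ∀ x y : X, F i x y → F (i + 1) x y) ∧
      (∀ x y : X, E x y ↔ ∃ i, F i x y))
    (n k : ℕ) (hn : 1 < n) (hk : 1 < k)
    (c : Finset X → Fin k) (hcBorel : IsBorelColoring n c)
    (hcat : AlmostTransitive E n c) :
    ∃ S : X → ℕ → X, Measurable S ∧ IsMonochromaticReduction E n c S := by
  obtain ⟨F, h1, h2, h3, h4, h5⟩ := hhyperfinite
  exact monochromatic_reduction_aux E hE haper F h1 h2 h3 h4 h5 n k hn c hcBorel hcat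
end
end

section
/- Let X be a standard Borel space, let E be an aperiodic, countable Borel equivalence relation on X, and let n, k > 1 be integers. Then the strong Borel Ramsey property E →_B (E)^n_k holds if and only if for every Borel E-coloring c : [X]^n_E → {1,…,k} there exists a Borel function S : X → X^ℕ such that: (a) for every x ∈ X and distinct i, j ∈ ℕ, S(x)(i) ≠ S(x)(j); (b) for every x ∈ X, the set {S(x)(i) : i ∈ ℕ} is a monochromatic subset of [x]_E; (c) for all x, y ∈ X, x E y if and only if S(x) = S(y). Moreover, this remains equivalent when (c) is replaced by: (c') for all x, y ∈ X, if x E y then {S(x)(i) : i ∈ ℕ} = {S(y)(i) : i ∈ ℕ}. -/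
open Classical

noncomputable section

section LusinNovikov

variable {Z X : Type*}

/-- `A` is covered by countably many measurable sets on which `f` is injective. -/
def LNSmall [MeasurableSpace Z] (f : Z → X) (A : Set Z) : Prop :=
  ∃ 𝓡 : Set (Set Z), 𝓡.Countable ∧ (∀ R ∈ 𝓡, MeasurableSet R ∧ Set.InjOn f R) ∧ A ⊆ ⋃₀ 𝓡

theorem LNSmall.mono [MeasurableSpace Z] {f : Z → X} {A B : Set Z} (h : LNSmall f B)
    (hAB : A ⊆ B) : LNSmall f A := by
  obtain ⟨𝓡, h1, h2, h3⟩ := h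
  exact ⟨𝓡, h1, h2, hAB.trans h3⟩

theorem LNSmall.empty [MeasurableSpace Z] {f : Z → X} : LNSmall f (∅ : Set Z) :=
  ⟨∅, by simp, by simp, by simp⟩

theorem LNSmall.single [MeasurableSpace Z] {f : Z → X} {R : Set Z} (h1 : MeasurableSet R)
    (h2 : Set.InjOn f R) : LNSmall f R :=
  ⟨{R}, by simp, by simp [h1, h2], by simp⟩

theorem LNSmall.iUnion [MeasurableSpace Z] {f : Z → X} {ι : Type*} [Countable ι] {A : ι → Set Z}
    (h : ∀ i, LNSmall f (A i)) : LNSmall f (⋃ i, A i) := by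
  choose 𝓡 h1 h2 h3 using h
  refine ⟨⋃ i, 𝓡 i, Set.countable_iUnion h1, ?_, ?_⟩
  · intro R hR
    obtain ⟨i, hi⟩ := Set.mem_iUnion.1 hR
    exact h2 i R hi
  · intro z hz
    obtain ⟨i, hi⟩ := Set.mem_iUnion.1 hz
    obtain ⟨R, hR, hzR⟩ := h3 i hi
    exact ⟨R, Set.mem_iUnion.2 ⟨i, hR⟩, hzR⟩

theorem LNSmall.union [MeasurableSpace Z] {f : Z → X} {A B : Set Z} (h : LNSmall f A)
    (h' : LNSmall f B) : LNSmall f (A ∪ B) := by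
  rw [Set.union_eq_iUnion]
  refine LNSmall.iUnion fun b => ?_
  cases b <;> simpa

/-- A tuple of sets is small if the base is covered by measurable sets such that over the `i`-th
one the `i`-th set is small. -/
def LNSmallT [MeasurableSpace Z] [MeasurableSpace X] (f : Z → X) {ι : Type*} (A : ι → Set Z) :
    Prop :=
  ∃ B : ι → Set X, (∀ i, MeasurableSet (B i)) ∧ (∀ x, ∃ i, x ∈ B i) ∧
    ∀ i, LNSmall f (A i ∩ f ⁻¹' B i)

theorem LNSmallT.of_comp [MeasurableSpace Z] [MeasurableSpace X] {f : Z → X} {ι κ : Type*}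
    [Countable ι] {A : κ → Set Z} (p : ι → κ) (h : LNSmallT f (fun i => A (p i))) :
    LNSmallT f A := by
  obtain ⟨B, h1, h2, h3⟩ := h
  refine ⟨fun j => ⋃ i, ⋃ _ : p i = j, B i, ?_, ?_, ?_⟩
  · intro j
    exact MeasurableSet.iUnion fun i => MeasurableSet.iUnion fun _ => h1 i
  · intro x
    obtain ⟨i, hi⟩ := h2 x
    exact ⟨p i, Set.mem_iUnion₂.2 ⟨i, rfl, hi⟩⟩
  · intro j
    refine (LNSmall.iUnion h3).mono ?_
    rintro z ⟨hz, hz'⟩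
    obtain ⟨i, hi, hzi⟩ := Set.mem_iUnion₂.1 hz'
    subst hi
    exact Set.mem_iUnion.2 ⟨i, hz, hzi⟩

theorem LN_split [MeasurableSpace Z] [MeasurableSpace X] {f : Z → X} (hf : Measurable f)
    {ι J : Type*} [Finite ι] [Countable J] (U : J → Bool → Set Z)
    (hU : ∀ j b, MeasurableSet (U j b))
    (hsep : ∀ z z', z ≠ z' → ∃ j, z ∈ U j false ∧ z' ∈ U j true)
    {A : ι → Set Z} (hA : ¬ LNSmallT f A) :
    ∃ c : ι → J, ¬ LNSmallT f (fun p : ι × Bool => A p.1 ∩ U (c p.1) p.2) := by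
  by_contra! hcon
  choose B hB1 hB2 hB3 using hcon
  apply hA
  refine ⟨fun i => {x | ∀ j, ∃ c : ι → J, c i = j ∧ ∃ b, x ∈ B c (i, b)}, ?_, ?_, ?_⟩
  · intro i
    simp only [Set.ofPred_forall, Set.ofPred_exists, Set.ofPred_and]
    refine MeasurableSet.iInter fun j => MeasurableSet.iUnion fun c => ?_
    exact (MeasurableSet.const _).inter (MeasurableSet.iUnion fun b => hB1 c _)
  · intro x
    by_contra! hx
    simp only [Set.mem_ofPred_eq, not_forall] at hx
    choose c hc using hx
    obtain ⟨⟨i, b⟩, hi⟩ := hB2 c x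
    exact hc i ⟨c, rfl, b, hi⟩
  · intro i
    set Xi : Set X := {x | ∀ j, ∃ c : ι → J, c i = j ∧ ∃ b, x ∈ B c (i, b)} with hXi
    have hXm : MeasurableSet Xi := by
      simp only [hXi, Set.ofPred_forall, Set.ofPred_exists, Set.ofPred_and]
      refine MeasurableSet.iInter fun j => MeasurableSet.iUnion fun c => ?_
      exact (MeasurableSet.const _).inter (MeasurableSet.iUnion fun b => hB1 c _)
    let R : Set Z := f ⁻¹' Xi ∩ ⋂ c : ι → J, ⋂ b : Bool, (U (c i) b ∩ f ⁻¹' B c (i, b))ᶜ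
    have hRm : MeasurableSet R := by
      refine (hf hXm).inter (MeasurableSet.iInter fun c => MeasurableSet.iInter fun b => ?_)
      exact ((hU _ _).inter (hf (hB1 _ _))).compl
    have hRi : Set.InjOn f R := by
      rintro z ⟨hz1, hz2⟩ z' ⟨hz1', hz2'⟩ hzz
      by_contra hne
      obtain ⟨j, hj, hj'⟩ := hsep z z' hne
      obtain ⟨c, rfl, b, hb⟩ := hz1 j
      simp only [Set.mem_iInter] at hz2 hz2'
      cases b
      · exact hz2 c false ⟨hj, hb⟩
      · exact hz2' c true ⟨hj', by rw [Set.mem_preimage, ← hzz]; exact hb⟩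
    refine ((LNSmall.single hRm hRi).union
      (LNSmall.iUnion fun c => LNSmall.iUnion fun b => hB3 c (i, b))).mono ?_
    rintro z ⟨hzA, hzX⟩
    by_cases hzR : z ∈ R
    · exact Or.inl hzR
    · right
      have : ¬ ∀ c : ι → J, ∀ b : Bool, z ∈ (U (c i) b ∩ f ⁻¹' B c (i, b))ᶜ := by
        intro h
        exact hzR ⟨hzX, by simpa only [Set.mem_iInter] using h⟩
      push Not at this
      obtain ⟨c, b, h⟩ := this
      rw [Set.notMem_compl_iff] at h
      exact Set.mem_iUnion₂.2 ⟨c, b, ⟨hzA, h.1⟩, h.2⟩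

theorem LN_step [MetricSpace Z] [SecondCountableTopology Z] [MeasurableSpace Z] [BorelSpace Z]
    [MeasurableSpace X] {f : Z → X} (hf : Measurable f) (k : ℕ)
    (A : (Fin k → Bool) → Set Z) (hA : ¬ LNSmallT f A) :
    ∃ A' : (Fin (k + 1) → Bool) → Set Z, ¬ LNSmallT f A' ∧
      (∀ s, A' s ⊆ A (fun i => s i.castSucc)) ∧
      (∀ s, ∀ z ∈ A' s, ∀ w ∈ A' s, dist z w ≤ 2 / ((k : ℝ) + 1)) ∧
      (∀ s t, (fun i : Fin k => s i.castSucc) = (fun i : Fin k => t i.castSucc) →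
        s (Fin.last k) ≠ t (Fin.last k) → Disjoint (closure (A' s)) (closure (A' t))) := by
  have hZ : Nonempty Z := by
    by_contra h
    rw [not_nonempty_iff] at h
    apply hA
    refine ⟨fun _ => Set.univ, fun _ => MeasurableSet.univ, fun x => ⟨fun _ => false, trivial⟩,
      fun i => LNSmall.empty.mono ?_⟩
    intro z
    exact (IsEmpty.false z).elim
  let d : ℕ → Z := TopologicalSpace.denseSeq Z
  have hd : DenseRange d := TopologicalSpace.denseRange_denseSeq Z
  let r : ℕ → ℝ := fun m => 1 / ((m : ℝ) + 1)
  have hr : ∀ m, 0 < r m := fun m => by positivity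
  let J := {j : ℕ × ℕ × ℕ // k ≤ j.2.2 ∧ 2 * r j.2.2 < dist (d j.1) (d j.2.1)}
  let U : J → Bool → Set Z := fun j b =>
    Metric.ball (d (if b then j.1.2.1 else j.1.1)) (r j.1.2.2)
  obtain ⟨c, hc⟩ := LN_split hf (J := J) U (fun j b => Metric.isOpen_ball.measurableSet) (by
    intro z z' hne
    have hpos : 0 < dist z z' := dist_pos.2 hne
    obtain ⟨m0, hm0⟩ := exists_nat_one_div_lt (show (0:ℝ) < dist z z' / 4 by positivity)
    let m := max m0 k
    have hm : r m < dist z z' / 4 := by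
      refine lt_of_le_of_lt ?_ hm0
      apply one_div_le_one_div_of_le (by positivity)
      have : (m0 : ℝ) ≤ (m : ℝ) := by exact_mod_cast le_max_left _ _
      linarith
    obtain ⟨a, ha⟩ := hd.exists_dist_lt z (hr m)
    obtain ⟨b, hb⟩ := hd.exists_dist_lt z' (hr m)
    refine ⟨⟨(a, b, m), le_max_right _ _, ?_⟩, ?_, ?_⟩
    · have h1 := dist_triangle4 z (d a) (d b) z'
      have h2 : dist (d b) z' < r m := by rw [dist_comm]; exact hb
      show 2 * r m < dist (d a) (d b)
      linarith
    · simpa [U] using ha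
    · simpa [U] using hb) hA
  refine ⟨fun s => A (fun i => s i.castSucc) ∩ U (c (fun i => s i.castSucc)) (s (Fin.last k)),
    ?_, ?_, ?_, ?_⟩
  · intro h
    exact hc (LNSmallT.of_comp (f := f)
      (A := fun p : (Fin k → Bool) × Bool => A p.1 ∩ U (c p.1) p.2)
      (fun s : Fin (k + 1) → Bool => ((fun i => s i.castSucc), s (Fin.last k))) h)
  · intro s
    exact Set.inter_subset_left
  · rintro s z ⟨-, hz⟩ w ⟨-, hw⟩
    have h1 := (c (fun i => s i.castSucc)).2.1
    have h2 : r (c (fun i => s i.castSucc)).1.2.2 ≤ 1 / ((k : ℝ) + 1) := by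
      apply one_div_le_one_div_of_le (by positivity)
      have : (k : ℝ) ≤ ((c (fun i => s i.castSucc)).1.2.2 : ℝ) := by exact_mod_cast h1
      linarith
    have h3 := dist_triangle_right z w
      (d (if s (Fin.last k) then (c (fun i => s i.castSucc)).1.2.1
        else (c (fun i => s i.castSucc)).1.1))
    have h4 := Metric.mem_ball.1 hz
    have h5 := Metric.mem_ball.1 hw
    have h6 : 2 / ((k : ℝ) + 1) = 1 / ((k : ℝ) + 1) + 1 / ((k : ℝ) + 1) := by ring
    linarith
  · intro s t hst hne
    have key : ∀ j : J, Disjoint (closure (U j false)) (closure (U j true)) := by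
      intro j
      refine Disjoint.mono Metric.closure_ball_subset_closedBall
        Metric.closure_ball_subset_closedBall ?_
      apply Metric.closedBall_disjoint_closedBall
      have := j.2.2
      simp only [if_true, Bool.false_eq_true, if_false]
      linarith
    have hcl : ∀ u : Fin (k+1) → Bool, closure (A (fun i => u i.castSucc) ∩
        U (c (fun i => u i.castSucc)) (u (Fin.last k))) ⊆
        closure (U (c (fun i => u i.castSucc)) (u (Fin.last k))) := fun u =>
      closure_mono Set.inter_subset_right
    refine Disjoint.mono (hcl s) (hcl t) ?_
    rw [hst]
    rcases hs : s (Fin.last k) <;> rcases ht : t (Fin.last k)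
    · rw [hs, ht] at hne; exact absurd rfl hne
    · exact key _
    · exact (key _).symm
    · rw [hs, ht] at hne; exact absurd rfl hne

theorem LN_main [TopologicalSpace Z] [PolishSpace Z] [MeasurableSpace Z] [BorelSpace Z]
    [TopologicalSpace X] [T2Space X] [MeasurableSpace X] [OpensMeasurableSpace X] {f : Z → X}
    (hfm : Measurable f) (hf : Continuous f) (hcount : ∀ x, (f ⁻¹' {x}).Countable) :
    LNSmall f (Set.univ : Set Z) := by
  let := TopologicalSpace.upgradeIsCompletelyMetrizable Z
  by_contra hbig
  have h0 : ¬ LNSmallT f (fun _ : Fin 0 → Bool => (Set.univ : Set Z)) := by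
    rintro ⟨B, -, h2, h3⟩
    apply hbig
    refine (LNSmall.iUnion h3).mono ?_
    intro z _
    obtain ⟨i, hi⟩ := h2 (f z)
    exact Set.mem_iUnion.2 ⟨i, trivial, hi⟩
  choose! nxt hn1 hn2 hn3 hn4 using fun k => LN_step (Z := Z) hfm k
  let A : ∀ k, (Fin k → Bool) → Set Z := fun k =>
    Nat.rec (motive := fun k => (Fin k → Bool) → Set Z) (fun _ => Set.univ)
      (fun k a => nxt k a) k
  have hbigA : ∀ k, ¬ LNSmallT f (A k) := by
    intro k
    induction k with
    | zero => exact h0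
    | succ k ih => exact hn1 k _ ih
  have hsub : ∀ k s, A (k+1) s ⊆ A k (fun i => s i.castSucc) := fun k s => hn2 k _ (hbigA k) s
  have hdiam : ∀ k s, ∀ z ∈ A (k+1) s, ∀ w ∈ A (k+1) s, dist z w ≤ 2 / ((k : ℝ) + 1) :=
    fun k s => hn3 k _ (hbigA k) s
  have hdisj : ∀ k (s t : Fin (k+1) → Bool),
      (fun i : Fin k => s i.castSucc) = (fun i : Fin k => t i.castSucc) →
        s (Fin.last k) ≠ t (Fin.last k) → Disjoint (closure (A (k+1) s)) (closure (A (k+1) t)) :=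
    fun k s t => hn4 k _ (hbigA k) s t
  have hne : ∀ k s, (A k s).Nonempty := by
    intro k s
    by_contra h
    rw [Set.not_nonempty_iff_eq_empty] at h
    apply hbigA k
    refine ⟨fun t => if t = s then Set.univ else ∅, ?_, ?_, ?_⟩
    · intro t
      dsimp only
      split_ifs <;> simp
    · intro x
      exact ⟨s, by simp⟩
    · intro t
      refine LNSmall.empty.mono ?_
      by_cases hts : t = s
      · subst hts; simp [h]
      · simp [hts]
  let rs : (ℕ → Bool) → ∀ k, Fin k → Bool := fun α k i => α i
  have hanti : ∀ α : ℕ → Bool, Antitone (fun k => A k (rs α k)) := fun α =>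
    antitone_nat_of_succ_le fun k => hsub k (rs α (k+1))
  choose a ha using fun (α : ℕ → Bool) (k : ℕ) => hne k (rs α k)
  have hlim0 : Filter.Tendsto (fun k : ℕ => 2 / ((k : ℝ) + 1)) Filter.atTop (nhds 0) := by
    have := (tendsto_one_div_add_atTop_nhds_zero_nat (𝕜 := ℝ)).const_mul 2
    simpa [div_eq_mul_inv] using this
  have hcau : ∀ α, CauchySeq (fun k => a α (k+1)) := by
    intro α
    refine cauchySeq_of_le_tendsto_0 (fun k : ℕ => 2 / ((k : ℝ) + 1)) ?_ hlim0
    intro n m N hn hm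
    exact hdiam N (rs α (N+1)) _ (hanti α (Nat.succ_le_succ hn) (ha α (n+1))) _
      (hanti α (Nat.succ_le_succ hm) (ha α (m+1)))
  choose z hz using fun α => cauchySeq_tendsto_of_complete (hcau α)
  have hzcl : ∀ α k, z α ∈ closure (A k (rs α k)) := by
    intro α k
    refine mem_closure_of_tendsto (hz α) ?_
    filter_upwards [Filter.eventually_ge_atTop k] with n hn
    exact hanti α (hn.trans (Nat.le_succ n)) (ha α (n+1))
  have hnear : ∀ α (W : Set Z), IsOpen W → z α ∈ W → ∃ K, ∀ k ≥ K, A k (rs α k) ⊆ W := by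
    intro α W hW hzW
    obtain ⟨ε, hε, hball⟩ := Metric.isOpen_iff.1 hW _ hzW
    obtain ⟨K, hK⟩ := (hlim0.eventually (gt_mem_nhds (show (0:ℝ) < ε / 2 by positivity))).exists
    refine ⟨K + 1, fun k hk w hw => hball ?_⟩
    have hw' := hanti α hk hw
    obtain ⟨v, hv, hvd⟩ := Metric.mem_closure_iff.1 (hzcl α (K+1)) (ε/2) (by positivity)
    have h1 := hdiam K _ w hw' v hv
    have h2 := dist_triangle_right w (z α) v
    rw [Metric.mem_ball]
    linarith
  have hconst : ∀ α β, f (z α) = f (z β) := by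
    intro α β
    by_contra hfne
    obtain ⟨B, B', hB, hB', hαB, hβB, hBB⟩ := t2_separation hfne
    obtain ⟨K, hK⟩ := hnear α _ (hB.preimage hf) hαB
    obtain ⟨K', hK'⟩ := hnear β _ (hB'.preimage hf) hβB
    let k := max K K'
    have h1 := hK k (le_max_left _ _)
    have h2 := hK' k (le_max_right _ _)
    have hab : rs α k ≠ rs β k := by
      intro h
      have h3 := ha α k
      have h4 := h1 h3
      rw [h] at h3
      exact Set.disjoint_left.1 hBB h4 (h2 h3)
    apply hbigA k
    refine ⟨fun t => if t = rs α k then Bᶜ else if t = rs β k then B else ∅, ?_, ?_, ?_⟩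
    · intro t
      dsimp only
      split_ifs
      · exact hB.measurableSet.compl
      · exact hB.measurableSet
      · exact MeasurableSet.empty
    · intro x
      by_cases hx : x ∈ B
      · refine ⟨rs β k, ?_⟩
        simp [hab.symm, hx]
      · refine ⟨rs α k, ?_⟩
        simp [hx]
    · intro t
      refine LNSmall.empty.mono ?_
      rintro w ⟨hw, hw'⟩
      rw [Set.mem_preimage] at hw'
      dsimp only at hw'
      split_ifs at hw' with c1 c2
      · subst c1; exact hw' (h1 hw)
      · subst c2; exact Set.disjoint_left.1 hBB hw' (h2 hw)
      · exact hw'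
  have hinj : Function.Injective z := by
    intro α β hαβ
    by_contra hne'
    have hex : ∃ k, α k ≠ β k := by
      by_contra! h
      exact hne' (funext h)
    let k := Nat.find hex
    have hk : α k ≠ β k := Nat.find_spec hex
    have hlt : ∀ i < k, α i = β i := fun i hi => by
      have := Nat.find_min hex hi
      push Not at this
      exact this
    have := hdisj k (rs α (k+1)) (rs β (k+1)) (by
      funext i
      exact hlt i i.2) hk
    refine Set.disjoint_left.1 this (hzcl α (k+1)) ?_
    rw [hαβ]
    exact hzcl β (k+1)
  have hc := hcount (f (z (fun _ => false)))
  have : (Set.range z).Countable := hc.mono (by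
    rintro _ ⟨α, rfl⟩
    exact hconst _ _)
  have h2 : Countable (ℕ → Bool) := by
    have h3 : Countable (Set.range z) := this.to_subtype
    exact (Equiv.ofInjective z hinj).injective.countable
  obtain ⟨e, he⟩ := exists_surjective_nat (ℕ → Bool)
  obtain ⟨n, hn⟩ := he (fun n => !(e n n))
  have h3 := congrFun hn n
  simp at h3

end LusinNovikov

section Enumeration

variable {X : Type*} [MeasurableSpace X] [StandardBorelSpace X]

theorem LN_measurable {Z X : Type*} [MeasurableSpace X] [StandardBorelSpace X]
    [MeasurableSpace Z] [StandardBorelSpace Z] {f : Z → X} (hf : Measurable f)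
    (hcount : ∀ x, (f ⁻¹' {x}).Countable) : LNSmall f (Set.univ : Set Z) := by
  obtain ⟨τX, hbX, hpX⟩ := StandardBorelSpace.polish (α := X)
  obtain ⟨τZ, hbZ, hpZ⟩ := StandardBorelSpace.polish (α := Z)
  obtain ⟨t', hle, hfc, hp'⟩ := hf.exists_continuous
  have hb' : @BorelSpace Z t' _ := by
    constructor
    rw [MeasureTheory.borel_eq_borel_of_le hp' hpZ hle]
    exact hbZ.measurable_eq
  exact @LN_main Z X t' hp' _ hb' τX _ _ _ f hf hfc hcount

theorem cber_enum (E : X → X → Prop) (hrefl : ∀ x, E x x)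
    (hEBorel : MeasurableSet {p : X × X | E p.1 p.2})
    (hcount : ∀ x : X, {y | E x y}.Countable) :
    ∃ g : ℕ → X → X, (∀ m, Measurable (g m)) ∧ ∀ x y, E x y ↔ ∃ m, g m x = y := by
  let Z := {p : X × X | E p.1 p.2}
  have hZ : StandardBorelSpace Z := hEBorel.standardBorel
  let f : Z → X := fun z => z.1.1
  let q : Z → X := fun z => z.1.2
  have hf : Measurable f := measurable_fst.comp measurable_subtype_coe
  have hq : Measurable q := measurable_snd.comp measurable_subtype_coe
  have hsmall : LNSmall f (Set.univ : Set Z) := by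
    apply LN_measurable hf
    intro x
    refine Set.MapsTo.countable_of_injOn (f := q) (t := {y | E x y}) ?_ ?_ (hcount x)
    · rintro z hz
      have h1 : f z = x := hz
      have h2 := z.2
      show E x (q z)
      rw [← h1]
      exact h2
    · rintro z hz w hw hzw
      have h1 : f z = x := hz
      have h2 : f w = x := hw
      exact Subtype.ext (Prod.ext (h1.trans h2.symm) hzw)
  obtain ⟨𝓡, h1, h2, h3⟩ := hsmall
  obtain ⟨R, hR⟩ := (h1.insert ∅).exists_eq_range (Set.insert_nonempty _ _)
  have hRm : ∀ i, MeasurableSet (R i) ∧ Set.InjOn f (R i) := by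
    intro i
    have : R i ∈ insert ∅ 𝓡 := hR ▸ Set.mem_range_self i
    rcases this with h | h
    · rw [h]; simp
    · exact h2 _ h
  have hRc : ∀ z, ∃ i, z ∈ R i := by
    intro z
    obtain ⟨S, hS, hz⟩ := h3 (Set.mem_univ z)
    have : S ∈ Set.range R := hR ▸ Set.mem_insert_of_mem _ hS
    obtain ⟨i, rfl⟩ := this
    exact ⟨i, hz⟩
  let g : ℕ → X → X := fun i x => if hx : ∃ z ∈ R i, f z = x then q (Classical.choose hx) else x
  have hg1 : ∀ i, ∀ z ∈ R i, g i (f z) = q z := by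
    intro i z hz
    have hx : ∃ w ∈ R i, f w = f z := ⟨z, hz, rfl⟩
    have hspec := Classical.choose_spec hx
    have : Classical.choose hx = z := (hRm i).2 hspec.1 hz hspec.2
    simp only [g]
    rw [dif_pos hx, this]
  have hg2 : ∀ i x, x ∉ f '' R i → g i x = x := by
    intro i x hx
    exact dif_neg (fun h => hx h)
  refine ⟨g, ?_, ?_⟩
  · intro i B hB
    have : g i ⁻¹' B = f '' (R i ∩ q ⁻¹' B) ∪ ((f '' R i)ᶜ ∩ B) := by
      ext x
      by_cases hx : x ∈ f '' R i
      · obtain ⟨z, hz, rfl⟩ := hx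
        rw [Set.mem_preimage, hg1 i z hz]
        constructor
        · intro h
          exact Or.inl ⟨z, ⟨hz, h⟩, rfl⟩
        · rintro (⟨w, ⟨hw, hwB⟩, hwz⟩ | ⟨h, -⟩)
          · rw [← (hRm i).2 hw hz hwz]; exact hwB
          · exact absurd ⟨z, hz, rfl⟩ h
      · rw [Set.mem_preimage, hg2 i x hx]
        constructor
        · intro h
          exact Or.inr ⟨hx, h⟩
        · rintro (⟨w, ⟨hw, hwB⟩, hwz⟩ | ⟨-, h⟩)
          · exact absurd ⟨w, hw, hwz⟩ hx
          · exact h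
    rw [this]
    have m1 := ((hRm i).1.inter (hq hB)).image_of_measurable_injOn hf
      ((hRm i).2.mono Set.inter_subset_left)
    have m2 := (hRm i).1.image_of_measurable_injOn hf (hRm i).2
    exact m1.union (m2.compl.inter hB)
  · intro x y
    constructor
    · intro h
      obtain ⟨i, hi⟩ := hRc ⟨(x, y), h⟩
      exact ⟨i, hg1 i _ hi⟩
    · rintro ⟨i, rfl⟩
      by_cases hx : x ∈ f '' R i
      · obtain ⟨z, hz, rfl⟩ := hx
        rw [hg1 i z hz]
        exact z.2
      · rw [hg2 i x hx]
        exact hrefl x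

/-- Feldman–Moore: `E` is generated by countably many Borel involutions. -/
theorem cber_involutions (E : X → X → Prop) (hE : Equivalence E)
    (hEBorel : MeasurableSet {p : X × X | E p.1 p.2})
    (hcount : ∀ x : X, {y | E x y}.Countable) :
    ∃ g : ℕ → X → X, (∀ m, Measurable (g m)) ∧ (∀ m x, g m (g m x) = x) ∧
      ∀ x y, E x y ↔ ∃ m, g m x = y := by
  obtain ⟨f, hfm, hf⟩ := cber_enum E hE.refl hEBorel hcount
  obtain ⟨τX, hbX, hpX⟩ := StandardBorelSpace.polish (α := X)
  let 𝓑 := TopologicalSpace.countableBasis X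
  have h𝓑 : TopologicalSpace.IsTopologicalBasis 𝓑 := TopologicalSpace.isBasis_countableBasis X
  obtain ⟨U, hU⟩ := ((TopologicalSpace.countable_countableBasis X).insert ∅).exists_eq_range
    (Set.insert_nonempty _ _)
  have hUo : ∀ l, MeasurableSet (U l) := by
    intro l
    have : U l ∈ insert ∅ 𝓑 := hU ▸ Set.mem_range_self l
    rcases this with h | h
    · rw [h]; simp
    · exact (h𝓑.isOpen h).measurableSet
  have hUs : ∀ x y, x ≠ y → ∃ l, x ∈ U l ∧ y ∉ U l := by
    intro x y hxy
    obtain ⟨V, hV, hxV, hVs⟩ := h𝓑.exists_subset_of_mem_open (u := {y}ᶜ) hxy isOpen_compl_singleton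
    have : V ∈ Set.range U := hU ▸ Set.mem_insert_of_mem _ hV
    obtain ⟨l, rfl⟩ := this
    exact ⟨l, hxV, fun h => hVs h rfl⟩
  let A : ℕ × ℕ × ℕ → Set X := fun p =>
    {x | f p.2.1 (f p.1 x) = x} ∩ (U p.2.2 ∩ f p.1 ⁻¹' (U p.2.2)ᶜ)
  let B : ℕ × ℕ × ℕ → Set X := fun p =>
    {y | f p.1 (f p.2.1 y) = y} ∩ (f p.2.1 ⁻¹' (U p.2.2) ∩ (U p.2.2)ᶜ)
  let G : ℕ × ℕ × ℕ → X → X := fun p x => if x ∈ A p then f p.1 x else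
    if x ∈ B p then f p.2.1 x else x
  have hA : ∀ p, MeasurableSet (A p) := fun p =>
    (measurableSet_eq_fun ((hfm _).comp (hfm _)) measurable_id).inter
      ((hUo _).inter (hfm _ (hUo _).compl))
  have hB : ∀ p, MeasurableSet (B p) := fun p =>
    (measurableSet_eq_fun ((hfm _).comp (hfm _)) measurable_id).inter
      ((hfm _ (hUo _)).inter (hUo _).compl)
  have hAB : ∀ p x, x ∈ A p → x ∉ B p := fun p x h h' => h'.2.2 h.2.1
  have hGA : ∀ p x, x ∈ A p → G p x = f p.1 x := fun p x h => by simp only [G]; rw [if_pos h]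
  have hGB : ∀ p x, x ∈ B p → G p x = f p.2.1 x := fun p x h => by
    simp only [G]; rw [if_neg (fun h' => hAB p x h' h), if_pos h]
  have hGC : ∀ p x, x ∉ A p → x ∉ B p → G p x = x := fun p x h h' => by
    simp only [G]; rw [if_neg h, if_neg h']
  have hAtoB : ∀ p x, x ∈ A p → f p.1 x ∈ B p := by
    rintro p x ⟨h1, h2, h3⟩
    have h1' : f p.2.1 (f p.1 x) = x := h1
    refine ⟨?_, ?_, h3⟩
    · show f p.1 (f p.2.1 (f p.1 x)) = f p.1 x
      rw [h1']
    · rw [Set.mem_preimage, h1']; exact h2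
  have hBtoA : ∀ p x, x ∈ B p → f p.2.1 x ∈ A p := by
    rintro p x ⟨h1, h2, h3⟩
    have h1' : f p.1 (f p.2.1 x) = x := h1
    refine ⟨?_, h2, ?_⟩
    · show f p.2.1 (f p.1 (f p.2.1 x)) = f p.2.1 x
      rw [h1']
    · rw [Set.mem_preimage, h1']; exact h3
  have hEf : ∀ i x, E x (f i x) := fun i x => (hf _ _).2 ⟨i, rfl⟩
  have hGm : ∀ p, Measurable (G p) := fun p =>
    Measurable.ite (hA p) (hfm _) (Measurable.ite (hB p) (hfm _) measurable_id)
  have hGi : ∀ p x, G p (G p x) = x := by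
    intro p x
    by_cases hxA : x ∈ A p
    · rw [hGA p x hxA, hGB p _ (hAtoB p x hxA)]; exact hxA.1
    · by_cases hxB : x ∈ B p
      · rw [hGB p x hxB, hGA p _ (hBtoA p x hxB)]; exact hxB.1
      · rw [hGC p x hxA hxB, hGC p x hxA hxB]
  have hGE : ∀ p x, E x (G p x) := by
    intro p x
    by_cases hxA : x ∈ A p
    · rw [hGA p x hxA]; exact hEf _ _
    · by_cases hxB : x ∈ B p
      · rw [hGB p x hxB]; exact hEf _ _
      · rw [hGC p x hxA hxB]; exact hE.refl x
  obtain ⟨e, he⟩ := exists_surjective_nat (Option (ℕ × ℕ × ℕ))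
  refine ⟨fun m => (e m).elim id G, ?_, ?_, ?_⟩
  · intro m
    dsimp only
    cases e m with
    | none => exact measurable_id
    | some p => exact hGm p
  · intro m x
    dsimp only
    cases e m with
    | none => rfl
    | some p => exact hGi p x
  · intro x y
    constructor
    · intro hxy
      by_cases hne : x = y
      · obtain ⟨m, hm⟩ := he none
        refine ⟨m, ?_⟩
        dsimp only
        rw [hm]; exact hne
      · obtain ⟨i, hi⟩ := (hf x y).1 hxy
        obtain ⟨j, hj⟩ := (hf y x).1 (hE.symm hxy)
        obtain ⟨l, hl, hl'⟩ := hUs x y hne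
        obtain ⟨m, hm⟩ := he (some (i, j, l))
        refine ⟨m, ?_⟩
        dsimp only
        rw [hm]
        show G (i, j, l) x = y
        rw [hGA]
        · exact hi
        · refine ⟨?_, hl, ?_⟩
          · show f j (f i x) = x
            rw [hi, hj]
          · show f i x ∉ U l
            rw [hi]; exact hl'
    · rintro ⟨m, rfl⟩
      dsimp only
      cases e m with
      | none => exact hE.refl x
      | some p => exact hGE p x

/-- A Polish topology for which countably many Borel self-maps become continuous. -/
theorem exists_polish_continuous (g : ℕ → X → X) (hg : ∀ m, Measurable (g m)) :
    ∃ t : TopologicalSpace X, @PolishSpace X t ∧ @BorelSpace X t _ ∧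
      ∀ m, @Continuous X X t t (g m) := by
  obtain ⟨τX, hbX, hpX⟩ := StandardBorelSpace.polish (α := X)
  have step : ∀ t : TopologicalSpace X, @PolishSpace X t ∧ @BorelSpace X t _ →
      ∃ t' : TopologicalSpace X, (@PolishSpace X t' ∧ @BorelSpace X t' _) ∧ t' ≤ t ∧
        ∀ m, @Continuous X X t' t (g m) := by
    rintro t ⟨hp, hb⟩
    choose T hT1 hT2 hT3 using fun m => (hg m).exists_continuous
    obtain ⟨t', h1, h2, h3⟩ := PolishSpace.exists_polishSpace_forall_le T hT1 hT3
    refine ⟨t', ⟨h3, ?_⟩, h2, fun m => ?_⟩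
    · constructor
      rw [MeasureTheory.borel_eq_borel_of_le h3 hp h2]
      exact hb.measurable_eq
    · exact continuous_le_dom (h1 m) (hT2 m)
  choose! nxt hn1 hn2 hn3 using step
  let T : ℕ → TopologicalSpace X := fun k => Nat.rec τX (fun _ t => nxt t) k
  have hT : ∀ k, @PolishSpace X (T k) ∧ @BorelSpace X (T k) _ := by
    intro k
    induction k with
    | zero => exact ⟨hpX, hbX⟩
    | succ k ih => exact hn1 _ ih
  have hTle : ∀ k, T k ≤ T 0 := by
    intro k
    induction k with
    | zero => exact le_rfl
    | succ k ih => exact (hn2 _ (hT k)).trans ih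
  have hp : @PolishSpace X (⨅ k, T k) := PolishSpace.iInf ⟨0, hTle⟩ fun k => (hT k).1
  refine ⟨⨅ k, T k, hp, ?_, ?_⟩
  · refine @BorelSpace.mk X (⨅ k, T k) _ ?_
    rw [MeasureTheory.borel_eq_borel_of_le hp hpX (iInf_le T 0)]
    exact hbX.measurable_eq
  · intro m
    rw [continuous_iInf_rng]
    intro k
    exact continuous_le_dom (iInf_le T (k+1)) (hn3 _ (hT k) m)

end Enumeration

section BaireLemma

open Topology Filter in
theorem baire_orbit {K : Type*} [TopologicalSpace K] [PolishSpace K] [MeasurableSpace K]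
    [BorelSpace K] (h : ℕ → K → K) (hc : ∀ m, Continuous (h m))
    (hinv : ∀ m z, h m (h m z) = z)
    (z0 : K) (hz0 : Dense {w | ∃ m, h m z0 = w})
    (hcomp : ∀ i j z, ∃ m, h m (h i z) = h j z)
    (Y : Set K) (hY : MeasurableSet Y) (hmeet : ∀ z, ∃ m, h m z ∈ Y) :
    ∃ U : Set K, IsOpen U ∧ U.Nonempty ∧ ∃ z, Dense {w | ∃ m, h m z = w} ∧
      ∀ m, h m z ∈ U → h m z ∈ Y := by
  obtain ⟨U, hU, hYU⟩ := hY.residualEq_isOpen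
  have hopen : ∀ m, IsOpenMap (h m) := by
    intro m s hs
    have : h m '' s = h m ⁻¹' s := by
      ext y
      constructor
      · rintro ⟨x, hx, rfl⟩
        show h m (h m x) ∈ s
        rw [hinv]; exact hx
      · intro hy
        exact ⟨h m y, hy, hinv m y⟩
    rw [this]
    exact hs.preimage (hc m)
  have hres : ∀ᶠ z in residual K, ∀ m, (h m z ∈ Y ↔ h m z ∈ U) := by
    rw [eventually_countable_forall]
    intro m
    have h1 : ∀ᶠ z in residual K, (z ∈ Y ↔ z ∈ U) := by
      filter_upwards [hYU] with z hz
      exact iff_of_eq hz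
    exact (tendsto_residual_of_isOpenMap (hc m) (hopen m)).eventually h1
  have hdense : ∀ᶠ z in residual K, ∀ V ∈ TopologicalSpace.countableBasis K, V.Nonempty → ∃ m, h m z ∈ V := by
    rw [eventually_countable_ball (TopologicalSpace.countable_countableBasis K)]
    intro V hV
    by_cases hne : V.Nonempty
    · have ho : IsOpen V := TopologicalSpace.isOpen_of_mem_countableBasis hV
      have : {z | ∃ m, h m z ∈ V} ∈ residual K := by
        apply residual_of_dense_open
        · have : {z | ∃ m, h m z ∈ V} = ⋃ m, h m ⁻¹' V := by ext z; simp
          rw [this]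
          exact isOpen_iUnion fun m => ho.preimage (hc m)
        · refine hz0.mono ?_
          rintro _ ⟨i, rfl⟩
          obtain ⟨w, ⟨j, rfl⟩, hw⟩ := hz0.exists_mem_open ho hne
          obtain ⟨m, hm⟩ := hcomp i j z0
          exact ⟨m, by rw [hm]; exact hw⟩
      filter_upwards [this] with z hz _
      exact hz
    · exact Filter.Eventually.of_forall fun z hz => absurd hz hne
  have : Nonempty K := ⟨z0⟩
  obtain ⟨z, hz1, hz2⟩ := (dense_of_mem_residual (hres.and hdense)).nonempty
  have hUne : U.Nonempty := by
    obtain ⟨m, hm⟩ := hmeet z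
    exact ⟨_, (hz1 m).1 hm⟩
  refine ⟨U, hU, hUne, z, ?_, fun m hm => (hz1 m).2 hm⟩
  rw [(TopologicalSpace.isBasis_countableBasis K).dense_iff]
  intro V hV hne
  obtain ⟨m, hm⟩ := hz2 V hV hne
  exact ⟨_, hm, m, rfl⟩

end BaireLemma

section BadColoring

/-- the total pairwise distance of a tuple -/
def tupleRho {X : Type*} [MetricSpace X] {n : ℕ} (v : Fin n → X) : ℝ :=
  ∑ i, ∑ j, dist (v i) (v j)

theorem tupleRho_continuous {X : Type*} [MetricSpace X] {n : ℕ} :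
    Continuous (tupleRho : (Fin n → X) → ℝ) := by
  unfold tupleRho
  fun_prop

theorem small_tuple {X : Type*} [MetricSpace X] (C : Set X)
    (hC : ∀ U : Set X, IsOpen U → ∀ y ∈ C, y ∈ U → ∃ y' ∈ C, y' ∈ U ∧ y' ≠ y)
    (n : ℕ) (hn : 1 < n) (V : Set X) (hV : IsOpen V) (hne : (C ∩ V).Nonempty) (ε : ℝ)
    (hε : 0 < ε) :
    ∃ v : Fin n → X, Function.Injective v ∧ (∀ l, v l ∈ C ∧ v l ∈ V) ∧
      0 < tupleRho v ∧ tupleRho v < ε := by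
  obtain ⟨y, hyC, hyV⟩ := hne
  obtain ⟨δ0, hδ0, hb0⟩ := Metric.isOpen_iff.1 hV y hyV
  have hn0 : (0 : ℝ) < n := by exact_mod_cast (by omega : 0 < n)
  let δ := min δ0 (ε / (4 * (n * n)))
  have hδ : 0 < δ := lt_min hδ0 (by positivity)
  have hδ2 : δ ≤ ε / (4 * (n * n)) := min_le_right _ _
  have hinf : (C ∩ Metric.ball y δ).Infinite := by
    intro hfin
    have hop : IsOpen (Metric.ball y δ ∩ ((C ∩ Metric.ball y δ) \ {y})ᶜ) :=
      Metric.isOpen_ball.inter (hfin.subset Set.sdiff_subset).isClosed.isOpen_compl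
    obtain ⟨y', h1, h2, h3⟩ := hC _ hop y hyC ⟨Metric.mem_ball_self hδ, fun h => h.2 rfl⟩
    exact h2.2 ⟨⟨h1, h2.1⟩, h3⟩
  let e := hinf.natEmbedding
  have hmem : ∀ m, (e m : X) ∈ C ∩ Metric.ball y δ := fun m => (e m).2
  have hinj : Function.Injective fun l : Fin n => (e l : X) := by
    intro a b hab
    exact Fin.ext (e.injective (Subtype.ext hab))
  have hd : ∀ a b, dist (e a : X) (e b) ≤ ε / (2 * (n * n)) := by
    intro a b
    have h1 := Metric.mem_ball.1 (hmem a).2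
    have h2 := Metric.mem_ball'.1 (hmem b).2
    have h3 := dist_triangle (e a : X) y (e b)
    have : ε / (2 * (n * n)) = 2 * (ε / (4 * (n * n))) := by field_simp; norm_num
    rw [this]
    linarith
  refine ⟨fun l => e l, hinj, fun l => ⟨(hmem l).1, hb0 ?_⟩, ?_, ?_⟩
  · exact Metric.ball_subset_ball (min_le_left _ _) (hmem l).2
  · unfold tupleRho
    refine Finset.sum_pos' (fun i _ => Finset.sum_nonneg fun j _ => dist_nonneg)
      ⟨⟨0, by omega⟩, Finset.mem_univ _, ?_⟩
    refine Finset.sum_pos' (fun j _ => dist_nonneg) ⟨⟨1, hn⟩, Finset.mem_univ _, ?_⟩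
    refine dist_pos.2 fun h => ?_
    have := hinj h
    simp at this
  · unfold tupleRho
    calc ∑ i : Fin n, ∑ j : Fin n, dist (e i : X) (e j)
        ≤ ∑ i : Fin n, ∑ j : Fin n, ε / (2 * (n * n)) :=
          Finset.sum_le_sum fun i _ => Finset.sum_le_sum fun j _ => hd i j
      _ = ε / 2 := by
          simp only [Finset.sum_const, Finset.card_univ, Fintype.card_fin, nsmul_eq_mul]
          field_simp
      _ < ε := by linarith

theorem radius_seq {X : Type*} [MetricSpace X] (C : Set X)
    (hC : ∀ U : Set X, IsOpen U → ∀ y ∈ C, y ∈ U → ∃ y' ∈ C, y' ∈ U ∧ y' ≠ y)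
    (n : ℕ) (hn : 1 < n) (V : ℕ → Set X) (hV : ∀ i, IsOpen (V i)) :
    ∃ r : ℕ → ℝ, StrictAnti r ∧ ∀ i j, i ≤ j → (C ∩ V i).Nonempty →
      ∃ v : Fin n → X, Function.Injective v ∧ (∀ l, v l ∈ C ∧ v l ∈ V i) ∧
        r (j + 1) < tupleRho v ∧ tupleRho v < r j := by
  have step : ∀ j : ℕ, ∀ r : {r : ℝ // 0 < r}, ∃ r' : {r : ℝ // 0 < r}, r'.1 < r.1 ∧
      ∀ i ≤ j, (C ∩ V i).Nonempty →
      ∃ v : Fin n → X, Function.Injective v ∧ (∀ l, v l ∈ C ∧ v l ∈ V i) ∧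
        r'.1 < tupleRho v ∧ tupleRho v < r.1 := by
    rintro j ⟨r, hr⟩
    have h1 : ∀ i, ∃ w : ℝ, 0 < w ∧ w ≤ r ∧ ((C ∩ V i).Nonempty →
        ∃ v : Fin n → X, Function.Injective v ∧ (∀ l, v l ∈ C ∧ v l ∈ V i) ∧
          w = tupleRho v ∧ tupleRho v < r) := by
      intro i
      by_cases h : (C ∩ V i).Nonempty
      · obtain ⟨v, a, b, c, d⟩ := small_tuple C hC n hn (V i) (hV i) h r hr
        exact ⟨_, c, d.le, fun _ => ⟨v, a, b, rfl, d⟩⟩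
      · exact ⟨r, hr, le_rfl, fun h' => absurd h' h⟩
    choose w hw1 hw2 hw3 using h1
    have hne : (Finset.range (j + 1)).Nonempty := ⟨0, by simp⟩
    have hpos : 0 < (Finset.range (j + 1)).inf' hne w := by
      rw [Finset.lt_inf'_iff]
      exact fun i _ => hw1 i
    have hle : ∀ i ≤ j, (Finset.range (j + 1)).inf' hne w ≤ w i := fun i hi =>
      Finset.inf'_le _ (Finset.mem_range.2 (by omega))
    refine ⟨⟨(Finset.range (j + 1)).inf' hne w / 2, by positivity⟩, ?_, ?_⟩
    · have := (hle 0 (Nat.zero_le _)).trans (hw2 0)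
      show (Finset.range (j + 1)).inf' hne w / 2 < r
      linarith
    · intro i hi hne'
      obtain ⟨v, a, b, c, d⟩ := hw3 i hne'
      refine ⟨v, a, b, ?_, d⟩
      have := hle i hi
      show (Finset.range (j + 1)).inf' hne w / 2 < _
      linarith
  choose nxt hn1 hn2 using step
  let R : ℕ → {r : ℝ // 0 < r} := fun j => Nat.rec ⟨1, one_pos⟩ (fun j r => nxt j r) j
  refine ⟨fun j => (R j).1, strictAnti_nat_of_succ_lt fun j => hn1 j (R j), ?_⟩
  intro i j hij hne
  exact hn2 j (R j) i hij hne

/-- color of a real number along a decreasing sequence -/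
def realColor (r : ℕ → ℝ) (k : ℕ) (hk : 1 < k) (t : ℝ) : Fin k :=
  if ∃ j, Even j ∧ r (j + 1) < t ∧ t < r j then ⟨1, hk⟩ else ⟨0, by omega⟩

theorem realColor_measurable (r : ℕ → ℝ) (k : ℕ) (hk : 1 < k) :
    Measurable (realColor r k hk) := by
  refine Measurable.ite ?_ measurable_const measurable_const
  have : {t | ∃ j, Even j ∧ r (j + 1) < t ∧ t < r j} = ⋃ j, ⋃ (_ : Even j), Set.Ioo (r (j+1)) (r j) := by
    ext t; simp only [Set.mem_ofPred_eq, Set.mem_iUnion, Set.mem_Ioo, exists_prop]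
  rw [this]
  exact MeasurableSet.iUnion fun j => MeasurableSet.iUnion fun _ => measurableSet_Ioo

theorem realColor_even (r : ℕ → ℝ) (k : ℕ) (hk : 1 < k) (t : ℝ) (j : ℕ) (hj : Even j)
    (h1 : r (j + 1) < t) (h2 : t < r j) : realColor r k hk t = ⟨1, hk⟩ :=
  if_pos ⟨j, hj, h1, h2⟩

theorem realColor_odd (r : ℕ → ℝ) (hr : StrictAnti r) (k : ℕ) (hk : 1 < k) (t : ℝ) (j : ℕ)
    (hj : ¬ Even j)
    (h1 : r (j + 1) < t) (h2 : t < r j) : realColor r k hk t = ⟨0, by omega⟩ := by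
  refine if_neg ?_
  rintro ⟨i, hi, h3, h4⟩
  have a : i < j + 1 := hr.lt_iff_gt.1 (h1.trans h4)
  have b : j < i + 1 := hr.lt_iff_gt.1 (h3.trans h2)
  have : i = j := by omega
  exact hj (this ▸ hi)

/-- the coloring of finite sets by total distance -/
def badColor {X : Type*} [MetricSpace X] (r : ℕ → ℝ) (n k : ℕ) (hk : 1 < k) (A : Finset X) :
    Fin k :=
  if A.card = n then realColor r k hk (∑ a ∈ A, ∑ b ∈ A, dist a b) else ⟨0, by omega⟩

theorem badColor_image {X : Type*} [MetricSpace X] (r : ℕ → ℝ) (n k : ℕ) (hk : 1 < k)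
    (v : Fin n → X) (hv : Function.Injective v) :
    badColor r n k hk (Finset.univ.image v) = realColor r k hk (tupleRho v) := by
  unfold badColor
  rw [if_pos (by rw [Finset.card_image_of_injective _ hv]; simp)]
  congr 1
  unfold tupleRho
  rw [Finset.sum_image (fun a _ b _ h => hv h)]
  refine Finset.sum_congr rfl fun a _ => ?_
  rw [Finset.sum_image (fun a _ b _ h => hv h)]

theorem badColor_borel {X : Type*} [MetricSpace X] [SecondCountableTopology X]
    [MeasurableSpace X] [BorelSpace X] (r : ℕ → ℝ) (n k : ℕ) (hk : 1 < k) :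
    IsBorelColoring n (badColor (X := X) r n k hk) := by
  unfold IsBorelColoring
  have h : (fun v : Fin n → X => badColor r n k hk (Set.finite_range v).toFinset) =
      fun v => if Function.Injective v then realColor r k hk (tupleRho v) else ⟨0, by omega⟩ := by
    funext v
    have himg : (Set.finite_range v).toFinset = Finset.univ.image v := by
      ext x; simp
    rw [himg]
    split_ifs with hv
    · exact badColor_image r n k hk v hv
    · unfold badColor
      rw [if_neg]
      intro hc
      apply hv
      have : (Finset.univ.image v).card = (Finset.univ : Finset (Fin n)).card := by simp [hc]
      have := Finset.card_image_iff.1 this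
      simpa [Set.injOn_univ] using this
  rw [h]
  refine Measurable.ite ?_ ?_ measurable_const
  · have : {v : Fin n → X | Function.Injective v} =
        ⋂ i, ⋂ j, ⋂ (_ : i ≠ j), {v | v i = v j}ᶜ := by
      ext v
      simp only [Set.mem_ofPred_eq, Set.mem_iInter, Set.mem_compl_iff, Function.Injective]
      exact ⟨fun h i j hij h' => hij (h h'), fun h i j h' => by_contra fun hij => h i j hij h'⟩
    rw [this]
    exact MeasurableSet.iInter fun i => MeasurableSet.iInter fun j => MeasurableSet.iInter fun _ =>
      (measurableSet_eq_fun (measurable_pi_apply i) (measurable_pi_apply j)).compl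
  · exact (realColor_measurable r k hk).comp tupleRho_continuous.measurable

theorem bad_coloring {X : Type*} [MeasurableSpace X] [TopologicalSpace X] [PolishSpace X]
    [BorelSpace X] (E : X → X → Prop) (hE : Equivalence E) (g : ℕ → X → X)
    (hgc : ∀ m, Continuous (g m)) (hinv : ∀ m x, g m (g m x) = x)
    (hgE : ∀ x y, E x y ↔ ∃ m, g m x = y) (n k : ℕ) (hn : 1 < n) (hk : 1 < k) (x0 : X)
    (hx0 : ∀ U : Set X, IsOpen U → ∀ y ∈ {y | E x0 y}, y ∈ U →
      ∃ y' ∈ {y | E x0 y}, y' ∈ U ∧ y' ≠ y) :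
    ¬ StrongBorelRamsey E n k := by
  intro hram
  let _ := TopologicalSpace.upgradeIsCompletelyMetrizable X
  have hEg : ∀ m x, E x (g m x) := fun m x => (hgE _ _).2 ⟨m, rfl⟩
  set C : Set X := {y | E x0 y} with hCdef
  obtain ⟨V, hVr⟩ := ((TopologicalSpace.countable_countableBasis X).insert ∅).exists_eq_range
    (Set.insert_nonempty _ _)
  have h𝓑 := TopologicalSpace.isBasis_countableBasis X
  have hVo : ∀ l, IsOpen (V l) := by
    intro l
    have : V l ∈ insert ∅ (TopologicalSpace.countableBasis X) := hVr ▸ Set.mem_range_self l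
    rcases this with h | h
    · rw [h]; simp
    · exact h𝓑.isOpen h
  obtain ⟨r, hr, hrv⟩ := radius_seq C hx0 n hn V hVo
  obtain ⟨Y, hY, hYinf, hYmono⟩ := hram (badColor r n k hk) (badColor_borel r n k hk)
  have hKp : PolishSpace (closure C) := isClosed_closure.polishSpace
  have hmap : ∀ m, ∀ z ∈ closure C, g m z ∈ closure C := by
    intro m z hz
    exact map_mem_closure (hgc m) hz fun y hy => hE.trans hy (hEg m y)
  let h : ℕ → closure C → closure C := fun m z => ⟨g m z, hmap m z z.2⟩
  have hxC : x0 ∈ C := hE.refl x0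
  obtain ⟨U, hU, ⟨u, hu⟩, z, hzd, hzY⟩ := baire_orbit h
    (fun m => ((hgc m).comp continuous_subtype_val).subtype_mk _)
    (fun m z => Subtype.ext (hinv m z)) ⟨x0, subset_closure hxC⟩
    (by
      rw [Subtype.dense_iff]
      refine closure_mono ?_
      intro y hy
      obtain ⟨m, hm⟩ := (hgE x0 y).1 hy
      exact ⟨h m ⟨x0, subset_closure hxC⟩, ⟨m, rfl⟩, hm⟩)
    (by
      intro i j z
      obtain ⟨m, hm⟩ := (hgE (g i z) (g j z)).1 (hE.trans (hE.symm (hEg i z)) (hEg j z))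
      exact ⟨m, Subtype.ext hm⟩)
    (Subtype.val ⁻¹' Y) (measurable_subtype_coe hY)
    (by
      intro z
      obtain ⟨y, hy, hzy⟩ := (hYinf z).nonempty
      obtain ⟨m, hm⟩ := (hgE _ _).1 hzy
      exact ⟨m, by show g m z ∈ Y; rw [hm]; exact hy⟩)
  obtain ⟨W, hW, rfl⟩ := isOpen_induced_iff.1 hU
  obtain ⟨V0, hV0, huV, hVW⟩ := h𝓑.exists_subset_of_mem_open (show (u : X) ∈ W from hu) hW
  have : V0 ∈ Set.range V := hVr ▸ Set.mem_insert_of_mem _ hV0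
  obtain ⟨i, rfl⟩ := this
  have hCV : (C ∩ V i).Nonempty := by
    obtain ⟨y, h1, h2⟩ := mem_closure_iff.1 u.2 (V i) (hVo i) huV
    exact ⟨y, h2, h1⟩
  obtain ⟨a, ha⟩ := hYmono z
  have key : ∀ j, i ≤ j → ∃ t, r (j + 1) < t ∧ t < r j ∧ realColor r k hk t = a := by
    intro j hij
    obtain ⟨v, hv1, hv2, hv3, hv4⟩ := hrv i j hij hCV
    let cv : (Fin n → closure C) → (Fin n → X) := fun w l => w l
    have hcv : Continuous cv := by fun_prop
    let O : Set (Fin n → X) := {w | (∀ l, w l ∈ V i) ∧ (∀ l l', l ≠ l' → w l ≠ w l') ∧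
      r (j + 1) < tupleRho w ∧ tupleRho w < r j}
    have hO : IsOpen O := by
      have : O = (⋂ l, (fun w : Fin n → X => w l) ⁻¹' V i) ∩
          ((⋂ l, ⋂ l', ⋂ (_ : l ≠ l'), {w : Fin n → X | w l = w l'}ᶜ) ∩
            tupleRho ⁻¹' Set.Ioo (r (j+1)) (r j)) := by
        ext w
        simp only [O, Set.mem_ofPred_eq, Set.mem_inter_iff, Set.mem_iInter, Set.mem_preimage,
          Set.mem_compl_iff, Set.mem_Ioo, ne_eq]
      rw [this]
      refine (isOpen_iInter_of_finite fun l => (hVo i).preimage (continuous_apply l)).inter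
        ((isOpen_iInter_of_finite fun l => isOpen_iInter_of_finite fun l' =>
          isOpen_iInter_of_finite fun _ => ?_).inter (isOpen_Ioo.preimage tupleRho_continuous))
      exact (isClosed_eq (continuous_apply l) (continuous_apply l')).isOpen_compl
    have hd : Dense (Set.pi Set.univ fun _ : Fin n => {w | ∃ m, h m z = w}) :=
      dense_pi Set.univ fun _ _ => hzd
    obtain ⟨w, hwO, hw⟩ := hd.inter_open_nonempty (cv ⁻¹' O) (hO.preimage hcv)
      ⟨fun l => ⟨v l, subset_closure (hv2 l).1⟩,
        ⟨fun l => (hv2 l).2, fun l l' hl h' => hl (hv1 h'), hv3, hv4⟩⟩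
    obtain ⟨o1, o2, o3, o4⟩ := hwO
    have hwi : Function.Injective (cv w) := fun l l' hl => by_contra fun hne => o2 l l' hne hl
    refine ⟨tupleRho (cv w), o3, o4, ?_⟩
    rw [← badColor_image r n k hk (cv w) hwi]
    apply ha
    · rw [Finset.card_image_of_injective _ hwi]; simp
    · intro y hy
      obtain ⟨l, -, rfl⟩ := Finset.mem_image.1 (Finset.mem_coe.1 hy)
      obtain ⟨m, hm⟩ := hw l (Set.mem_univ l)
      have h1 : h m z ∈ Subtype.val ⁻¹' W := by rw [hm]; exact hVW (o1 l)
      have h2 := hzY m h1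
      rw [hm] at h2
      exact h2
    · intro y hy
      obtain ⟨l, -, rfl⟩ := Finset.mem_image.1 hy
      obtain ⟨m, hm⟩ := hw l (Set.mem_univ l)
      have : cv w l = g m z := by
        show (w l : X) = _
        rw [← hm]
      rw [this]
      exact hEg m z
  obtain ⟨t1, a1, a2, a3⟩ := key (2 * i) (by omega)
  obtain ⟨t2, b1, b2, b3⟩ := key (2 * i + 1) (by omega)
  rw [realColor_even r k hk t1 (2 * i) (by simp) a1 a2] at a3
  rw [realColor_odd r hr k hk t2 (2 * i + 1) (by simp) b1 b2] at b3
  have := a3.trans b3.symm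
  simp [Fin.ext_iff] at this

end BadColoring

section Selector

variable {X : Type*} [MeasurableSpace X]

theorem measurable_natFind {P : X → ℕ → Prop} (hP : ∀ x, ∃ l, P x l)
    (hm : ∀ l, MeasurableSet {x | P x l}) : Measurable fun x => Nat.find (hP x) :=
  measurable_find hP hm

theorem measurable_select {Z : Type*} [MeasurableSpace Z] {g : ℕ → X → Z} (hg : ∀ m, Measurable (g m)) {N : X → ℕ}
    (hN : Measurable N) : Measurable fun x => g (N x) x := by
  have h1 : Measurable fun p : X × ℕ => g p.2 p.1 := measurable_from_prod_countable_left hg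
  exact h1.comp (measurable_id.prodMk hN)

theorem exists_selector [StandardBorelSpace X] (E : X → X → Prop) (hE : Equivalence E)
    (g : ℕ → X → X) (hg : ∀ m, Measurable (g m)) (hgE : ∀ x y, E x y ↔ ∃ m, g m x = y)
    (U : ℕ → Set X) (hU : ∀ l, MeasurableSet (U l))
    (hiso : ∀ x, ∃ l, ∃ y, E x y ∧ y ∈ U l ∧ ∀ y', E x y' → y' ∈ U l → y' = y) :
    ∃ s : X → X, Measurable s ∧ (∀ x, E x (s x)) ∧ ∀ x y, E x y → s x = s y := by
  obtain ⟨τX, hbX, hpX⟩ := StandardBorelSpace.polish (α := X)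
  have hEg : ∀ m x, E x (g m x) := fun m x => (hgE _ _).2 ⟨m, rfl⟩
  let P : X → ℕ → Prop := fun x l => ∃ m, g m x ∈ U l ∧ ∀ m', g m' x ∈ U l → g m' x = g m x
  have hP : ∀ x, ∃ l, P x l := by
    intro x
    obtain ⟨l, y, h1, h2, h3⟩ := hiso x
    obtain ⟨m, rfl⟩ := (hgE x y).1 h1
    exact ⟨l, m, h2, fun m' h => h3 _ (hEg _ _) h⟩
  have hPm : ∀ l, MeasurableSet {x | P x l} := by
    intro l
    have : {x | P x l} = ⋃ m, (g m ⁻¹' U l ∩ ⋂ m', ((g m' ⁻¹' U l)ᶜ ∪ {x | g m' x = g m x})) := by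
      ext x
      simp only [P, Set.mem_ofPred_eq, Set.mem_iUnion, Set.mem_inter_iff, Set.mem_iInter,
        Set.mem_union, Set.mem_compl_iff, Set.mem_preimage, imp_iff_not_or]
    rw [this]
    exact MeasurableSet.iUnion fun m => (hg m (hU l)).inter (MeasurableSet.iInter fun m' =>
      (hg m' (hU l)).compl.union (measurableSet_eq_fun (hg m') (hg m)))
  let L : X → ℕ := fun x => Nat.find (hP x)
  have hL : Measurable L := measurable_natFind hP hPm
  have hQ : ∀ x, ∃ m, g m x ∈ U (L x) := fun x => (Nat.find_spec (hP x)).imp fun m h => h.1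
  have hQm : ∀ m, MeasurableSet {x | g m x ∈ U (L x)} := by
    intro m
    have : {x | g m x ∈ U (L x)} = ⋃ l, (L ⁻¹' {l} ∩ g m ⁻¹' U l) := by
      ext x; simp
    rw [this]
    exact MeasurableSet.iUnion fun l => (hL (measurableSet_singleton l)).inter (hg m (hU l))
  refine ⟨fun x => g (Nat.find (hQ x)) x, measurable_select hg (measurable_natFind hQ hQm),
    fun x => hEg _ _, ?_⟩
  intro x y hxy
  have hPxy : ∀ x y l, E x y → P x l → P y l := by
    rintro x y l h ⟨m, h1, h2⟩
    obtain ⟨m1, hm1⟩ := (hgE y (g m x)).1 (hE.trans (hE.symm h) (hEg m x))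
    refine ⟨m1, by rw [hm1]; exact h1, fun m' h' => ?_⟩
    obtain ⟨m2, hm2⟩ := (hgE x (g m' y)).1 (hE.trans h (hEg m' y))
    rw [hm1, ← hm2]
    exact h2 m2 (by rw [hm2]; exact h')
  have hLxy : L x = L y := by
    apply le_antisymm
    · exact Nat.find_min' _ (hPxy y x _ (hE.symm hxy) (Nat.find_spec (hP y)))
    · exact Nat.find_min' _ (hPxy x y _ hxy (Nat.find_spec (hP x)))
  obtain ⟨m, h1, h2⟩ := Nat.find_spec (hP x)
  have hx := Nat.find_spec (hQ x)
  have hy := Nat.find_spec (hQ y)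
  dsimp only
  generalize Nat.find (hQ y) = b at hy ⊢
  rw [← hLxy] at hy
  obtain ⟨m2, hm2⟩ := (hgE x (g b y)).1 (hE.trans hxy (hEg _ y))
  rw [h2 _ hx, ← hm2]
  exact (h2 m2 (by rw [hm2]; exact hy)).symm

theorem exists_enum_reduction [StandardBorelSpace X] (E : X → X → Prop) (hE : Equivalence E)
    (g : ℕ → X → X) (hg : ∀ m, Measurable (g m)) (hgE : ∀ x y, E x y ↔ ∃ m, g m x = y)
    (s : X → X) (hs : Measurable s) (hsE : ∀ x, E x (s x)) (hsi : ∀ x y, E x y → s x = s y)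
    (Y : Set X) (hY : MeasurableSet Y) (hYinf : ∀ x, {y | y ∈ Y ∧ E x y}.Infinite) :
    ∃ S : X → ℕ → X, Measurable S ∧ (∀ x, Function.Injective (S x)) ∧
      (∀ x i, E x (S x i) ∧ S x i ∈ Y) ∧ (∀ x y, E x y ↔ S x = S y) := by
  obtain ⟨τX, hbX, hpX⟩ := StandardBorelSpace.polish (α := X)
  have hEg : ∀ m x, E x (g m x) := fun m x => (hgE _ _).2 ⟨m, rfl⟩
  let M : X → ℕ → Prop := fun x m => g m (s x) ∈ Y ∧ ∀ l < m, g l (s x) ≠ g m (s x)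
  have hMm : ∀ m, MeasurableSet {x | M x m} := by
    intro m
    have : {x | M x m} = (fun x => g m (s x)) ⁻¹' Y ∩ ⋂ l, ⋂ (_ : l < m), {x | g l (s x) = g m (s x)}ᶜ := by
      ext x
      simp [M]
    rw [this]
    exact (((hg m).comp hs) hY).inter (MeasurableSet.iInter fun l => MeasurableSet.iInter fun _ =>
      (measurableSet_eq_fun ((hg l).comp hs) ((hg m).comp hs)).compl)
  have hMinf : ∀ x, (Set.ofPred (M x)).Infinite := by
    intro x hfin
    refine hYinf x ((hfin.image fun m => g m (s x)).subset ?_)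
    rintro y ⟨hy, hxy⟩
    have hex : ∃ m, g m (s x) = y := (hgE _ _).1 (hE.trans (hE.symm (hsE x)) hxy)
    refine ⟨Nat.find hex, ⟨?_, ?_⟩, Nat.find_spec hex⟩
    · rw [Nat.find_spec hex]; exact hy
    · intro l hl
      rw [Nat.find_spec hex]
      exact Nat.find_min hex hl
  have hcm : ∀ m, Measurable fun x => Nat.count (M x) m := by
    intro m
    induction m with
    | zero => simp only [Nat.count_zero]; exact measurable_const
    | succ m ih =>
      simp only [Nat.count_succ]
      exact ih.add (Measurable.ite (hMm m) measurable_const measurable_const)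
  have hnm : ∀ i, Measurable fun x => Nat.nth (M x) i := by
    intro i
    refine measurable_to_countable' fun m => ?_
    have : (fun x => Nat.nth (M x) i) ⁻¹' {m} = {x | M x m} ∩ (fun x => Nat.count (M x) m) ⁻¹' {i} := by
      ext x
      constructor
      · intro h
        have h' : Nat.nth (M x) i = m := h
        subst h'
        exact ⟨Nat.nth_mem_of_infinite (hMinf x) i, Nat.count_nth_of_infinite (hMinf x) i⟩
      · rintro ⟨h1, h2⟩
        have h2' : Nat.count (M x) m = i := h2
        subst h2'
        exact Nat.nth_count h1
    rw [this]
    exact (hMm m).inter (hcm m (measurableSet_singleton i))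
  have hSE : ∀ x i, E x (g (Nat.nth (M x) i) (s x)) := fun x i => hE.trans (hsE x) (hEg _ _)
  refine ⟨fun x i => g (Nat.nth (M x) i) (s x), ?_, ?_, ?_, ?_⟩
  · exact measurable_pi_lambda _ fun i => measurable_select (fun m => (hg m).comp hs) (hnm i)
  · intro x i j hij
    have hi := Nat.nth_mem_of_infinite (hMinf x) i
    have hj := Nat.nth_mem_of_infinite (hMinf x) j
    dsimp only at hij
    apply Nat.nth_injective (hMinf x)
    rcases lt_trichotomy (Nat.nth (M x) i) (Nat.nth (M x) j) with h | h | h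
    · exact absurd hij (hj.2 _ h)
    · exact h
    · exact absurd hij.symm (hi.2 _ h)
  · intro x i
    exact ⟨hSE x i, (Nat.nth_mem_of_infinite (hMinf x) i).1⟩
  · intro x y
    constructor
    · intro h
      have : s x = s y := hsi x y h
      funext i
      simp only [M, this]
    · intro h
      have h0 := congrFun h 0
      dsimp only at h0
      exact hE.trans (hSE x 0) (h0 ▸ hE.symm (hSE y 0))

theorem ramsey_of_ranges [StandardBorelSpace X] (E : X → X → Prop) (n k : ℕ)
    (H : ∀ c : Finset X → Fin k, IsBorelColoring n c →
        ∃ S : X → ℕ → X, Measurable S ∧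
          (∀ x : X, Function.Injective (S x)) ∧
          (∀ x : X, (∀ i : ℕ, E x (S x i)) ∧
            ∃ a : Fin k, ∀ A : Finset X, A.card = n → ↑A ⊆ Set.range (S x) → c A = a) ∧
          (∀ x y : X, E x y → Set.range (S x) = Set.range (S y))) : StrongBorelRamsey E n k := by
  intro c hc
  obtain ⟨τX, hbX, hpX⟩ := StandardBorelSpace.polish (α := X)
  obtain ⟨S, hS, hinj, hmono, hr⟩ := H c hc
  have hsub : ∀ x y, (∃ i, S y i = y) → E x y → y ∈ Set.range (S x) := by
    rintro x y ⟨i, hi⟩ hxy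
    rw [hr x y hxy]
    exact ⟨i, hi⟩
  refine ⟨{y | ∃ i, S y i = y}, ?_, ?_, ?_⟩
  · have : {y | ∃ i, S y i = y} = ⋃ i, {y | S y i = y} := by ext y; simp
    rw [this]
    exact MeasurableSet.iUnion fun i =>
      measurableSet_eq_fun ((measurable_pi_apply i).comp hS) measurable_id
  · intro x
    refine (Set.infinite_range_of_injective (hinj x)).mono ?_
    rintro _ ⟨i, rfl⟩
    have hx := (hmono x).1 i
    refine ⟨?_, hx⟩
    have : S x i ∈ Set.range (S (S x i)) := hr _ _ hx ▸ Set.mem_range_self i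
    exact this
  · intro x
    obtain ⟨a, ha⟩ := (hmono x).2
    exact ⟨a, fun A hA hAY hAE => ha A hA fun y hy => hsub x y (hAY hy) (hAE y hy)⟩

end Selector


theorem exists_reduction_of_ramsey {X : Type*} [MeasurableSpace X] [StandardBorelSpace X]
    (E : X → X → Prop) (hE : Equivalence E)
    (hEBorel : MeasurableSet {p : X × X | E p.1 p.2})
    (hcount : ∀ x : X, {y | E x y}.Countable)
    (n k : ℕ) (hn : 1 < n) (hk : 1 < k) (hram : StrongBorelRamsey E n k) :
    ∀ c : Finset X → Fin k, IsBorelColoring n c →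
        ∃ S : X → ℕ → X, Measurable S ∧
          (∀ x : X, Function.Injective (S x)) ∧
          (∀ x : X, (∀ i : ℕ, E x (S x i)) ∧
            ∃ a : Fin k, ∀ A : Finset X, A.card = n → ↑A ⊆ Set.range (S x) → c A = a) ∧
          (∀ x y : X, E x y ↔ S x = S y) := by
  intro c hc
  obtain ⟨g, hgm, hginv, hgE⟩ := cber_involutions E hE hEBorel hcount
  obtain ⟨t, hp, hb, hgc⟩ := exists_polish_continuous g hgm
  have h𝓑 := TopologicalSpace.isBasis_countableBasis X
  obtain ⟨V, hVr⟩ := ((TopologicalSpace.countable_countableBasis X).insert ∅).exists_eq_range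
    (Set.insert_nonempty _ _)
  have hVm : ∀ l, MeasurableSet (V l) := by
    intro l
    have : V l ∈ insert ∅ (TopologicalSpace.countableBasis X) := hVr ▸ Set.mem_range_self l
    rcases this with h | h
    · rw [h]; simp
    · exact (h𝓑.isOpen h).measurableSet
  have hiso : ∀ x, ∃ l, ∃ y, E x y ∧ y ∈ V l ∧ ∀ y', E x y' → y' ∈ V l → y' = y := by
    intro x
    by_contra hcon
    push Not at hcon
    refine bad_coloring E hE g hgc hginv hgE n k hn hk x ?_ hram
    intro U hU y hy hyU
    obtain ⟨V0, hV0, hyV, hVU⟩ := h𝓑.exists_subset_of_mem_open hyU hU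
    have : V0 ∈ Set.range V := hVr ▸ Set.mem_insert_of_mem _ hV0
    obtain ⟨l, rfl⟩ := this
    obtain ⟨y', h1, h2, h3⟩ := hcon l y hy hyV
    exact ⟨y', h1, hVU h2, h3⟩
  obtain ⟨s, hs, hsE, hsi⟩ := exists_selector E hE g hgm hgE V hVm hiso
  obtain ⟨Y, hY, hYinf, hYmono⟩ := hram c hc
  obtain ⟨S, h1, h2, h3, h4⟩ := exists_enum_reduction E hE g hgm hgE s hs hsE hsi Y hY hYinf
  refine ⟨S, h1, h2, fun x => ⟨fun i => (h3 x i).1, ?_⟩, h4⟩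
  obtain ⟨a, ha⟩ := hYmono x
  refine ⟨a, fun A hA hAS => ha A hA ?_ ?_⟩
  · intro y hy
    obtain ⟨i, rfl⟩ := hAS hy
    exact (h3 x i).2
  · intro y hy
    obtain ⟨i, rfl⟩ := hAS hy
    exact (h3 x i).1

/-- Restatement of the strong Borel Ramsey property: `E →_B (E)^n_k` holds iff for every
Borel `E`-coloring `c` there is a Borel `S : X → X^ℕ` which is injective (a), has
monochromatic range inside each class (b), and satisfies `x E y ↔ S x = S y` (c); and this
remains equivalent when (c) is replaced by (c'): `x E y` implies
`range (S x) = range (S y)`. -/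
theorem strong_borel_ramsey_restatement {X : Type*} [MeasurableSpace X] [StandardBorelSpace X]
    (E : X → X → Prop) (hE : Equivalence E)
    (hEBorel : MeasurableSet {p : X × X | E p.1 p.2})
    (hcount : ∀ x : X, {y | E x y}.Countable)
    (haper : ∀ x : X, {y | E x y}.Infinite)
    (n k : ℕ) (hn : 1 < n) (hk : 1 < k) :
    (StrongBorelRamsey E n k ↔
      ∀ c : Finset X → Fin k, IsBorelColoring n c →
        ∃ S : X → ℕ → X, Measurable S ∧
          (∀ x : X, Function.Injective (S x)) ∧
          (∀ x : X, (∀ i : ℕ, E x (S x i)) ∧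
            ∃ a : Fin k, ∀ A : Finset X, A.card = n → ↑A ⊆ Set.range (S x) → c A = a) ∧
          (∀ x y : X, E x y ↔ S x = S y)) ∧
    (StrongBorelRamsey E n k ↔
      ∀ c : Finset X → Fin k, IsBorelColoring n c →
        ∃ S : X → ℕ → X, Measurable S ∧
          (∀ x : X, Function.Injective (S x)) ∧
          (∀ x : X, (∀ i : ℕ, E x (S x i)) ∧
            ∃ a : Fin k, ∀ A : Finset X, A.card = n → ↑A ⊆ Set.range (S x) → c A = a) ∧
          (∀ x y : X, E x y → Set.range (S x) = Set.range (S y))) := by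
  have hfwd := fun h => exists_reduction_of_ramsey E hE hEBorel hcount n k hn hk h
  refine ⟨⟨hfwd, fun H => ramsey_of_ranges E n k fun c hc => ?_⟩,
    ⟨fun h c hc => ?_, fun H => ramsey_of_ranges E n k H⟩⟩
  · obtain ⟨S, h1, h2, h3, h4⟩ := H c hc
    exact ⟨S, h1, h2, h3, fun x y hxy => by rw [(h4 x y).1 hxy]⟩
  · obtain ⟨S, h1, h2, h3, h4⟩ := hfwd h c hc
    exact ⟨S, h1, h2, h3, fun x y hxy => by rw [(h4 x y).1 hxy]⟩
end
end
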